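/- arXiv:1512.03044 — 10 statements merged into one kernel-verified Lean document; each statement's English description precedes it below -/
import Mathlib

section
/- Let n ≥ 3 and let λ = (λ_1,…,λ_k) be a composition of n−1 with λ_1 ≥ 2 and λ_k ≥ 2. Then the Gramian G_λ = H_λᵀ H_λ of the matrix H_λ is a strictly ultrametric matrix. -/
open Matrix BigOperators

/-- The unreduced upper Hessenberg 0/1-matrix `H_λ` associated with a composition
`λ = (λ_1, …, λ_K)` (given as `lam : Fin K → ℕ`, 0-indexed) of `n - 1`.
With 1-based indices: `σ_j = λ_1 + … + λ_j`, `β c` is the unique `j` with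
`σ_{j-1} < c ≤ σ_j`, the row-block `ρ r` is `0` for `r = 1` and `β (r-1)` otherwise,
and the column-block `γ c` is `β c` for `c ≤ n-1` and `K + 1` for `c = n`.
Then `H_λ(r,c) = 1` iff `r = c + 1`, or `ρ r < γ c` and `γ c - ρ r` is odd. -/
def Hmat (n K : ℕ) (lam : Fin K → ℕ) : Matrix (Fin n) (Fin n) ℝ :=
  Matrix.of fun i j =>
    let β : ℕ → ℕ := fun c =>
      ((Finset.range K).filter fun t => (∑ s : Fin K, if (s : ℕ) < t then lam s else 0) < c).card
    let ρ : ℕ → ℕ := fun r => if r = 1 then 0 else β (r - 1)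
    let γ : ℕ → ℕ := fun c => if c ≤ n - 1 then β c else K + 1
    if ((i : ℕ) = (j : ℕ) + 1) ∨
        (ρ ((i : ℕ) + 1) < γ ((j : ℕ) + 1) ∧ (γ ((j : ℕ) + 1) - ρ ((i : ℕ) + 1)) % 2 = 1)
    then 1 else 0

/-- A real symmetric `n × n` matrix is strictly ultrametric if its entries are
nonnegative, `A i j ≥ min (A i k) (A k j)` for all `i, j, k`, the diagonal strictly
dominates (`A i i > A i j` for `j ≠ i`), and for `n = 1` the single entry is positive. -/
def StrictlyUltrametric {n : ℕ} (A : Matrix (Fin n) (Fin n) ℝ) : Prop :=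
  A.IsSymm ∧ (∀ i j, 0 ≤ A i j) ∧ (∀ i j k, min (A i k) (A k j) ≤ A i j) ∧
    (∀ i j, j ≠ i → A i j < A i i) ∧ (n = 1 → ∀ i, 0 < A i i)

/-- The rows whose block lies an odd distance below `m`. -/
def oddBelow {n : ℕ} (ρ : Fin n → ℕ) (m : ℕ) : Finset (Fin n) :=
  {i | ρ i < m ∧ (m - ρ i) % 2 = 1}

/-- The support of column `j` of the Hessenberg matrix with row-blocks `ρ` and column-blocks `γ`. -/
def columnSupport {n : ℕ} (ρ γ : Fin n → ℕ) (j : Fin n) : Finset (Fin n) :=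
  {i | (i : ℕ) = j + 1 ∨ (ρ i < γ j ∧ (γ j - ρ i) % 2 = 1)}

theorem oddBelow_subset {n : ℕ} (ρ : Fin n → ℕ) {m m' : ℕ} (h : m ≤ m') (hp : m % 2 = m' % 2) :
    oddBelow ρ m ⊆ oddBelow ρ m' := by
  intro i
  simp only [oddBelow, Finset.mem_filter, Finset.mem_univ, true_and]
  omega

theorem oddBelow_card_pos {n : ℕ} (ρ : Fin n → ℕ) (h0 : ∃ i, ρ i = 0) (h1 : ∃ i, ρ i = 1)
    {m : ℕ} (hm : 1 ≤ m) : 1 ≤ (oddBelow ρ m).card := by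
  obtain ⟨i, hi⟩ := h0
  obtain ⟨j, hj⟩ := h1
  refine Finset.card_pos.2 ?_
  rcases Nat.mod_two_eq_zero_or_one m with hp | hp
  · refine ⟨j, ?_⟩
    simp only [oddBelow, Finset.mem_filter, Finset.mem_univ, true_and]
    omega
  · refine ⟨i, ?_⟩
    simp only [oddBelow, Finset.mem_filter, Finset.mem_univ, true_and]
    omega

section columnSupport

variable {n K : ℕ} {ρ γ : Fin n → ℕ}

theorem mem_columnSupport {i j : Fin n} : i ∈ columnSupport ρ γ j ↔
    (i : ℕ) = j + 1 ∨ (ρ i < γ j ∧ (γ j - ρ i) % 2 = 1) := by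
  simp [columnSupport]

theorem card_columnSupport_inter_of_le
    (hsub : ∀ i j : Fin n, (i : ℕ) = j + 1 → ρ i = γ j)
    (hlast : ∀ j : Fin n, (j : ℕ) + 1 = n → γ j = K + 1)
    (hle : ∀ j : Fin n, (j : ℕ) + 1 < n → γ j ≤ K)
    {c d : Fin n} (hcd : c ≠ d) (h : γ c ≤ γ d) :
    (columnSupport ρ γ c ∩ columnSupport ρ γ d).card =
      if γ c % 2 = γ d % 2 then (oddBelow ρ (γ c)).card else 1 := by
  have hne : (c : ℕ) ≠ d := fun h => hcd (Fin.ext h)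
  split_ifs with hp
  · congr 1
    ext i
    have hc := hsub i c
    have hd := hsub i d
    simp only [columnSupport, oddBelow, Finset.mem_inter, Finset.mem_filter, Finset.mem_univ,
      true_and]
    omega
  · have hc : (c : ℕ) + 1 < n := by
      by_contra hc
      have h1 := hlast c (by omega)
      by_cases hd : (d : ℕ) + 1 < n
      · have := hle d hd
        omega
      · omega
    refine Finset.card_eq_one.2 ⟨⟨c + 1, hc⟩, ?_⟩
    ext i
    have hc := hsub i c
    have hd := hsub i d
    simp only [columnSupport, Finset.mem_inter, Finset.mem_filter, Finset.mem_univ, true_and,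
      Finset.mem_singleton, Fin.ext_iff]
    omega

theorem card_columnSupport_inter
    (hsub : ∀ i j : Fin n, (i : ℕ) = j + 1 → ρ i = γ j)
    (hlast : ∀ j : Fin n, (j : ℕ) + 1 = n → γ j = K + 1)
    (hle : ∀ j : Fin n, (j : ℕ) + 1 < n → γ j ≤ K)
    {c d : Fin n} (hcd : c ≠ d) :
    (columnSupport ρ γ c ∩ columnSupport ρ γ d).card =
      if γ c % 2 = γ d % 2 then (oddBelow ρ (min (γ c) (γ d))).card else 1 := by
  rcases le_total (γ c) (γ d) with h | h
  · rw [min_eq_left h, card_columnSupport_inter_of_le hsub hlast hle hcd h]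
  · rw [min_eq_right h, Finset.inter_comm,
      card_columnSupport_inter_of_le hsub hlast hle hcd.symm h]
    simp only [eq_comm]

theorem oddBelow_subset_columnSupport (j : Fin n) : oddBelow ρ (γ j) ⊆ columnSupport ρ γ j := by
  intro i
  simp only [oddBelow, columnSupport, Finset.mem_filter, Finset.mem_univ, true_and]
  exact Or.inr

theorem card_columnSupport_inter_lt
    (hsub : ∀ i j : Fin n, (i : ℕ) = j + 1 → ρ i = γ j)
    (hlast : ∀ j : Fin n, (j : ℕ) + 1 = n → γ j = K + 1)
    (hle : ∀ j : Fin n, (j : ℕ) + 1 < n → γ j ≤ K) (hpos : ∀ j, 1 ≤ γ j)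
    (h0 : ∃ i, ρ i = 0) (h1 : ∃ i, ρ i = 1) (hK : ∃ p q, p ≠ q ∧ ρ p = K ∧ ρ q = K)
    {c d : Fin n} (hcd : c ≠ d) :
    (columnSupport ρ γ c ∩ columnSupport ρ γ d).card < (columnSupport ρ γ c).card := by
  have hne : (c : ℕ) ≠ d := fun h => hcd (Fin.ext h)
  rw [card_columnSupport_inter hsub hlast hle hcd]
  by_cases hc : (c : ℕ) + 1 < n
  · have hlt : (oddBelow ρ (γ c)).card < (columnSupport ρ γ c).card := by
      refine Finset.card_lt_card ((Finset.ssubset_iff_of_subset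
        (oddBelow_subset_columnSupport c)).2 ⟨⟨c + 1, hc⟩, ?_, ?_⟩)
      · simp [mem_columnSupport]
      · have := hsub ⟨c + 1, hc⟩ c rfl
        simp [oddBelow, this]
    have hone := oddBelow_card_pos ρ h0 h1 (hpos c)
    split_ifs with hp
    · refine lt_of_le_of_lt (Finset.card_le_card (oddBelow_subset ρ (min_le_left _ _) ?_)) hlt
      rcases min_choice (γ c) (γ d) with h | h <;> rw [h]
      exact hp.symm
    · omega
  · have hγ := hlast c (by omega)
    have hd := hle d (by omega)
    obtain ⟨p, q, hpq, hp, hq⟩ := hK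
    have hmem : ∀ i, ρ i = K → i ∈ columnSupport ρ γ c := by
      intro i hi
      rw [mem_columnSupport]
      omega
    split_ifs with hpar
    · rw [min_eq_right (by omega)]
      refine Finset.card_lt_card ((Finset.ssubset_iff_of_subset
        ((oddBelow_subset ρ (by omega) hpar.symm).trans
          (oddBelow_subset_columnSupport c))).2 ⟨p, hmem p hp, ?_⟩)
      simp only [oddBelow, Finset.mem_filter, Finset.mem_univ, true_and]
      omega
    · exact Finset.one_lt_card.2 ⟨p, hmem p hp, q, hmem q hq, hpq⟩

theorem min_card_columnSupport_inter_le
    (hsub : ∀ i j : Fin n, (i : ℕ) = j + 1 → ρ i = γ j)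
    (hlast : ∀ j : Fin n, (j : ℕ) + 1 = n → γ j = K + 1)
    (hle : ∀ j : Fin n, (j : ℕ) + 1 < n → γ j ≤ K) (hpos : ∀ j, 1 ≤ γ j)
    (h0 : ∃ i, ρ i = 0) (h1 : ∃ i, ρ i = 1) (c d e : Fin n) :
    min (columnSupport ρ γ c ∩ columnSupport ρ γ e).card
        (columnSupport ρ γ e ∩ columnSupport ρ γ d).card ≤
      (columnSupport ρ γ c ∩ columnSupport ρ γ d).card := by
  rcases eq_or_ne c d with rfl | hcd
  · exact (min_le_left _ _).trans
      (Finset.card_le_card (by simp))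
  rcases eq_or_ne c e with rfl | hce
  · exact min_le_right _ _
  rcases eq_or_ne e d with rfl | hed
  · exact min_le_left _ _
  rw [card_columnSupport_inter hsub hlast hle hcd, card_columnSupport_inter hsub hlast hle hce,
    card_columnSupport_inter hsub hlast hle hed]
  have hone := oddBelow_card_pos ρ h0 h1 (m := min (γ c) (γ d)) (le_min (hpos c) (hpos d))
  by_cases h₁ : γ c % 2 = γ e % 2 <;> by_cases h₂ : γ e % 2 = γ d % 2
  · rw [if_pos h₁, if_pos h₂, if_pos (h₁.trans h₂)]
    rcases le_total (γ c) (γ d) with h | h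
    · exact (min_le_left _ _).trans (Finset.card_le_card (oddBelow_subset ρ (by omega) (by omega)))
    · exact (min_le_right _ _).trans
        (Finset.card_le_card (oddBelow_subset ρ (by omega) (by omega)))
  · rw [if_neg h₂]
    refine (min_le_right _ _).trans ?_
    split_ifs <;> omega
  · rw [if_neg h₁]
    refine (min_le_left _ _).trans ?_
    split_ifs <;> omega
  · rw [if_neg h₁]
    refine (min_le_left _ _).trans ?_
    split_ifs <;> omega

theorem strictlyUltrametric_gramian_of_blocks (hn : n ≠ 1)
    (hsub : ∀ i j : Fin n, (i : ℕ) = j + 1 → ρ i = γ j)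
    (hlast : ∀ j : Fin n, (j : ℕ) + 1 = n → γ j = K + 1)
    (hle : ∀ j : Fin n, (j : ℕ) + 1 < n → γ j ≤ K) (hpos : ∀ j, 1 ≤ γ j)
    (h0 : ∃ i, ρ i = 0) (h1 : ∃ i, ρ i = 1) (hK : ∃ p q, p ≠ q ∧ ρ p = K ∧ ρ q = K)
    (H : Matrix (Fin n) (Fin n) ℝ)
    (hH : ∀ i j, H i j = if i ∈ columnSupport ρ γ j then 1 else 0) :
    StrictlyUltrametric (Hᵀ * H) := by
  have key : ∀ c d, (Hᵀ * H) c d =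
      ((columnSupport ρ γ c ∩ columnSupport ρ γ d).card : ℝ) := by
    intro c d
    simp only [Matrix.mul_apply, Matrix.transpose_apply, hH, ← ite_and, mul_ite, mul_one, mul_zero,
      Finset.sum_boole]
    congr 2
    ext i
    simp [and_comm]
  refine ⟨Matrix.isSymm_transpose_mul_self H, fun i j => ?_, fun c d e => ?_, fun c d hdc => ?_,
    fun h => absurd h hn⟩
  · rw [key]
    positivity
  · simp only [key]
    exact_mod_cast min_card_columnSupport_inter_le hsub hlast hle hpos h0 h1 c d e
  · simp only [key, Finset.inter_self]
    exact_mod_cast card_columnSupport_inter_lt hsub hlast hle hpos h0 h1 hK hdc.symm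

end columnSupport

/-- The index of the block of the composition `lam` that contains `c`. -/
def blockIndex {K : ℕ} (lam : Fin K → ℕ) (c : ℕ) : ℕ :=
  ((Finset.range K).filter fun t => (∑ s : Fin K, if (s : ℕ) < t then lam s else 0) < c).card

theorem blockIndex_le {K : ℕ} (lam : Fin K → ℕ) (c : ℕ) : blockIndex lam c ≤ K :=
  (Finset.card_filter_le _ _).trans (by simp)

theorem one_le_blockIndex {k : ℕ} (lam : Fin (k + 1) → ℕ) {c : ℕ} (hc : 1 ≤ c) :
    1 ≤ blockIndex lam c :=
  Finset.card_pos.2 ⟨0, by simp; omega⟩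

theorem blockIndex_one {k : ℕ} (lam : Fin (k + 1) → ℕ) (hfirst : 1 ≤ lam 0) :
    blockIndex lam 1 = 1 := by
  refine Finset.card_eq_one.2 ⟨0, ?_⟩
  ext t
  simp only [Finset.mem_filter, Finset.mem_range, Finset.mem_singleton]
  constructor
  · rintro ⟨-, ht⟩
    by_contra h
    have := Finset.single_le_sum (f := fun s : Fin (k + 1) => if (s : ℕ) < t then lam s else 0)
      (fun _ _ => Nat.zero_le _) (Finset.mem_univ 0)
    rw [if_pos (by rw [Fin.val_zero]; omega)] at this
    omega
  · rintro rfl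
    simp

theorem blockIndex_eq_of_lt {k : ℕ} (lam : Fin (k + 1) → ℕ) {c : ℕ}
    (hc : ∑ i, lam i < c + lam (Fin.last k)) : blockIndex lam c = k + 1 := by
  rw [blockIndex, Finset.filter_true_of_mem, Finset.card_range]
  intro t ht
  rw [Finset.mem_range] at ht
  rw [Fin.sum_univ_castSucc] at hc ⊢
  have : (∑ s : Fin k, if ((s.castSucc : Fin (k + 1)) : ℕ) < t then lam s.castSucc else 0) ≤
      ∑ s : Fin k, lam s.castSucc :=
    Finset.sum_le_sum fun s _ => by split_ifs <;> omega
  rw [if_neg (by rw [Fin.val_last]; omega)]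
  omega

/-- For `n ≥ 3` and a composition `λ = (λ_1,…,λ_k)` of `n - 1` with first and last
part at least `2`, the Gramian `H_λᵀ H_λ` is strictly ultrametric. -/
theorem gramian_Hmat_strictlyUltrametric (n k : ℕ) (hn : 3 ≤ n) (lam : Fin (k + 1) → ℕ)
    (hpos : ∀ i, 0 < lam i) (hsum : ∑ i, lam i = n - 1)
    (hfirst : 2 ≤ lam 0) (hlast : 2 ≤ lam (Fin.last k)) :
    StrictlyUltrametric ((Hmat n (k + 1) lam)ᵀ * Hmat n (k + 1) lam) := by
  have hrow : ∀ i : ℕ, i ≠ 0 → (if i + 1 = 1 then 0 else blockIndex lam (i + 1 - 1)) =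
      blockIndex lam i := fun i hi => by simp [hi]
  refine strictlyUltrametric_gramian_of_blocks (K := k + 1)
    (ρ := fun i => if (i : ℕ) + 1 = 1 then 0 else blockIndex lam (i + 1 - 1))
    (γ := fun j => if (j : ℕ) + 1 ≤ n - 1 then blockIndex lam (j + 1) else k + 1 + 1)
    (by omega) ?_ ?_ ?_ ?_ ⟨⟨0, by omega⟩, by simp⟩ ⟨⟨1, by omega⟩, ?_⟩
    ⟨⟨n - 2, by omega⟩, ⟨n - 1, by omega⟩, ?_, ?_, ?_⟩ _ ?_
  · intro i j hij
    have := i.isLt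
    rw [hrow i (by omega), if_pos (by omega), hij]
  · intro j hj
    exact if_neg (by omega)
  · intro j hj
    rw [if_pos (by omega)]
    exact blockIndex_le _ _
  · intro j
    split_ifs
    · exact one_le_blockIndex _ (by omega)
    · omega
  · exact (hrow 1 one_ne_zero).trans (blockIndex_one lam (by omega))
  · simp only [ne_eq, Fin.mk.injEq]
    omega
  · exact (hrow (n - 2) (by omega)).trans (blockIndex_eq_of_lt lam (by omega))
  · exact (hrow (n - 1) (by omega)).trans (blockIndex_eq_of_lt lam (by omega))
  · intro i j
    simp only [Hmat, Matrix.of_apply, mem_columnSupport, blockIndex]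
end

section
/- Let n ≥ 3 and let H be an n×n unreduced upper Hessenberg matrix with entries in {0,1} that represents an acute 0/1-simplex, i.e., H is invertible and (HᵀH)^{-1} has all off-diagonal entries negative and all row sums positive. Then there exists a composition λ = (λ_1,…,λ_k) of n−1 with λ_1 ≥ 2 and λ_k ≥ 2 such that H equals H_λ, possibly after exchanging the first two rows of H_λ and/or exchanging the last two columns of H_λ. -/
open Matrix BigOperators

/-- All entries of the matrix are `0` or `1`. -/
def ZeroOneEntries {m k : ℕ} (P : Matrix (Fin m) (Fin k) ℝ) : Prop :=
  ∀ i j, P i j = 0 ∨ P i j = 1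

/-- A matrix is unreduced upper Hessenberg if entries strictly below the first
subdiagonal vanish and all subdiagonal entries equal `1`. -/
def IsUnreducedUpperHessenberg {m k : ℕ} (H : Matrix (Fin m) (Fin k) ℝ) : Prop :=
  (∀ (i : Fin m) (j : Fin k), (j : ℕ) + 1 < (i : ℕ) → H i j = 0) ∧
    (∀ (j : Fin k) (h : (j : ℕ) + 1 < m), H ⟨(j : ℕ) + 1, h⟩ j = 1)

/-- A 0/1-matrix `P` (with linearly independent columns) represents an acute
0/1-simplex when the Gramian `PᵀP` is invertible and its inverse has all
off-diagonal entries negative and all row sums positive. -/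
def RepresentsAcute {m k : ℕ} (P : Matrix (Fin m) (Fin k) ℝ) : Prop :=
  IsUnit (Pᵀ * P).det ∧
    (∀ i j, i ≠ j → (Pᵀ * P)⁻¹ i j < 0) ∧
    (∀ i, 0 < ∑ j, (Pᵀ * P)⁻¹ i j)

open Finset

/-- `B` is, on indices below `k`, a left inverse of `G` with negative off-diagonal entries
and positive row sums. -/
structure IsAcuteInverse (G B : ℕ → ℕ → ℝ) (k : ℕ) : Prop where
  mul_eq : ∀ i < k, ∀ l < k, ∑ j ∈ range k, B i j * G j l = if i = l then 1 else 0
  neg : ∀ i < k, ∀ j < k, i ≠ j → B i j < 0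
  sum_pos : ∀ i < k, 0 < ∑ j ∈ range k, B i j

namespace IsAcuteInverse

variable {G B : ℕ → ℕ → ℝ} {k : ℕ}

lemma last_pos (h : IsAcuteInverse G B (k + 1)) : 0 < B k k := by
  have h1 := h.sum_pos k (by omega)
  rw [sum_range_succ] at h1
  have h2 : ∑ j ∈ range k, B k j ≤ 0 :=
    sum_nonpos fun j hj => (h.neg k (by omega) j (by simp at hj; omega)
      (by simp at hj; omega)).le
  linarith

/-- Passing to the Schur complement preserves acuteness. -/
lemma schur (h : IsAcuteInverse G B (k + 1)) :
    IsAcuteInverse G (fun i j => B i j - B i k / B k k * B k j) k where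
  mul_eq i hi l hl := by
    have hpos := h.last_pos
    have h1 := h.mul_eq i (by omega) l (by omega)
    have h2 := h.mul_eq k (by omega) l (by omega)
    rw [sum_range_succ] at h1 h2
    rw [if_neg (by omega)] at h2
    have : ∑ j ∈ range k, (B i j - B i k / B k k * B k j) * G j l
        = ∑ j ∈ range k, B i j * G j l - B i k / B k k * ∑ j ∈ range k, B k j * G j l := by
      rw [mul_sum, ← sum_sub_distrib]
      exact sum_congr rfl fun _ _ => by ring
    rw [this, ← h1, eq_neg_of_add_eq_zero_left h2]
    field_simp
    ring
  neg i hi j hj hij := by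
    have h1 := h.neg i (by omega) j (by omega) hij
    have h2 := h.neg i (by omega) k (by omega) (by omega)
    have h3 := h.neg k (by omega) j (by omega) (by omega)
    have := mul_pos_of_neg_of_neg (div_neg_of_neg_of_pos h2 h.last_pos) h3
    linarith
  sum_pos i hi := by
    have hpos := h.last_pos
    have h1 := h.sum_pos i (by omega)
    have h2 := h.sum_pos k (by omega)
    rw [sum_range_succ] at h1 h2
    have h3 := h.neg i (by omega) k (by omega) (by omega)
    rw [sum_sub_distrib, ← mul_sum]
    have h4 := mul_neg_of_neg_of_pos (div_neg_of_neg_of_pos h3 hpos) h2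
    rw [mul_add, div_mul_cancel₀ _ hpos.ne'] at h4
    linarith

lemma exists_of_le {n : ℕ} (h : IsAcuteInverse G B n) (hk : k ≤ n) :
    ∃ B', IsAcuteInverse G B' k := by
  induction n, hk using Nat.le_induction generalizing B with
  | base => exact ⟨B, h⟩
  | succ n _ ih => exact ih h.schur

/-- The orthogonal projection of the last vertex of an acute simplex onto the opposite facet
lies in the interior of that facet. -/
lemma exists_weights (h : IsAcuteInverse G B (k + 1)) :
    ∃ α : ℕ → ℝ, (∀ i < k, 0 < α i) ∧ ∑ i ∈ range k, α i < 1 ∧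
      ∀ l < k, G k l = ∑ i ∈ range k, α i * G i l := by
  have hpos := h.last_pos
  refine ⟨fun i => -B k i / B k k, fun i hi => ?_, ?_, fun l hl => ?_⟩
  · exact div_pos (neg_pos.2 (h.neg k (by omega) i (by omega) (by omega))) hpos
  · rw [← sum_div, div_lt_one hpos, sum_neg_distrib]
    have := h.sum_pos k (by omega)
    rw [sum_range_succ] at this
    linarith
  · have h2 := h.mul_eq k (by omega) l (by omega)
    rw [sum_range_succ, if_neg (by omega)] at h2
    have : ∑ i ∈ range k, -B k i / B k k * G i l
        = -(∑ i ∈ range k, B k i * G i l) / B k k := by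
      rw [← sum_neg_distrib, sum_div]
      exact sum_congr rfl fun _ _ => by ring
    rw [this, eq_neg_of_add_eq_zero_left h2]
    field_simp

end IsAcuteInverse

/-- The vector annihilated by the columns of an unreduced upper Hessenberg matrix `h`,
normalised by its first entry. -/
def leftKernel (h : ℕ → ℕ → ℝ) : ℕ → ℝ
  | 0 => 1
  | k + 1 => -∑ i : Fin (k + 1), leftKernel h i * h i k

lemma leftKernel_succ (h : ℕ → ℕ → ℝ) (k : ℕ) :
    leftKernel h (k + 1) = -∑ i ∈ range (k + 1), leftKernel h i * h i k := by
  rw [leftKernel, Fin.sum_univ_eq_sum_range (fun i => leftKernel h i * h i k)]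

/-- A vector orthogonal to the leading columns of an unreduced upper Hessenberg matrix is a
multiple of `leftKernel`. -/
lemma eq_mul_leftKernel {h : ℕ → ℕ → ℝ} {w : ℕ → ℝ} {j : ℕ}
    (hw : ∀ l < j, ∑ i ∈ range (l + 1), w i * h i l + w (l + 1) = 0) :
    ∀ i ≤ j, w i = w 0 * leftKernel h i := by
  intro i
  induction i using Nat.strong_induction_on with
  | _ i ih =>
    intro hi
    cases i with
    | zero => simp [leftKernel]
    | succ l =>
      rw [eq_neg_of_add_eq_zero_right (hw l (by omega)), leftKernel_succ, mul_neg, mul_sum]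
      congr 1
      refine sum_congr rfl fun i hi' => ?_
      rw [mem_range] at hi'
      rw [ih i hi' (by omega), mul_assoc]

/-- A positive sub-convex combination of `0/1` values, not all zero, lies in `(0,1)`. -/
lemma weighted_sum_mem_Ioo {α a : ℕ → ℝ} {k m : ℕ} (hα : ∀ i < k, 0 < α i)
    (hsum : ∑ i ∈ range k, α i < 1) (ha : ∀ i < k, a i = 0 ∨ a i = 1) (hm : m < k)
    (ham : a m = 1) : ∑ i ∈ range k, α i * a i ∈ Set.Ioo (0 : ℝ) 1 := by
  constructor
  · refine sum_pos' (fun i hi => ?_) ⟨m, mem_range.2 hm, by simp [ham, hα m hm]⟩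
    rcases ha i (mem_range.1 hi) with h | h <;> simp [h, (hα i (mem_range.1 hi)).le]
  · refine lt_of_le_of_lt (sum_le_sum fun i hi => ?_) hsum
    rcases ha i (mem_range.1 hi) with h | h <;> simp [h, (hα i (mem_range.1 hi)).le]

/-- Data of an `n × n` unreduced upper Hessenberg `0/1`-matrix indexed by `ℕ`, together with an
acute inverse of its Gramian. -/
structure IsAcuteHessenberg (n : ℕ) (h B : ℕ → ℕ → ℝ) : Prop where
  zero_or_one : ∀ i j, h i j = 0 ∨ h i j = 1
  eq_zero : ∀ i j, j + 1 < i → h i j = 0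
  sub_diag : ∀ j, j + 1 < n → h (j + 1) j = 1
  acute : IsAcuteInverse (fun a b => ∑ i ∈ range n, h i a * h i b) B n

namespace IsAcuteHessenberg

variable {n : ℕ} {h B : ℕ → ℕ → ℝ}

lemma sum_mul_col (hh : IsAcuteHessenberg n h B) (w : ℕ → ℝ) {l : ℕ} (hl : l + 1 < n) :
    ∑ i ∈ range n, w i * h i l = ∑ i ∈ range (l + 1), w i * h i l + w (l + 1) := by
  have : ∑ i ∈ range (l + 2), w i * h i l = ∑ i ∈ range n, w i * h i l := by
    refine sum_subset (by intro; simp; omega) fun i _ hi => ?_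
    rw [hh.eq_zero i l (by simp at hi; omega), mul_zero]
  rw [← this, sum_range_succ, hh.sub_diag l hl, mul_one]

/-- Column `j` minus its projection on the preceding columns is, on the first `j + 1` rows, a
multiple of `leftKernel h`. -/
lemma exists_residual (hh : IsAcuteHessenberg n h B) {j : ℕ} (hj : j < n) :
    ∃ c : ℝ, ∀ i ≤ j, (∃ l < j, h i l = 1) → h i j - c * leftKernel h i ∈ Set.Ioo (0 : ℝ) 1 := by
  obtain ⟨B', hB'⟩ := hh.acute.exists_of_le (k := j + 1) hj
  obtain ⟨α, hα, hsum, hG⟩ := hB'.exists_weights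
  set w : ℕ → ℝ := fun i => h i j - ∑ l ∈ range j, α l * h i l with hw
  have hker := eq_mul_leftKernel (h := h) (w := w) (j := j) fun l hl => by
    rw [← hh.sum_mul_col w (by omega)]
    simp only [hw, sub_mul, sum_sub_distrib, hG l hl, sum_mul, mul_sum]
    rw [sum_comm, sub_eq_zero]
    exact sum_congr rfl fun _ _ => sum_congr rfl fun _ _ => by ring
  refine ⟨w 0, fun i hi ⟨m, hm, him⟩ => ?_⟩
  rw [← hker i hi, hw, sub_sub_cancel]
  exact weighted_sum_mem_Ioo hα hsum (fun l _ => hh.zero_or_one i l) hm him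

lemma zero_zero (hh : IsAcuteHessenberg n h B) (hn : 2 ≤ n) : h 0 0 = 1 := by
  refine (hh.zero_or_one 0 0).resolve_left fun h0 => ?_
  obtain ⟨c, hc⟩ := hh.exists_residual (j := 1) (by omega)
  have := hc 1 le_rfl ⟨0, by omega, hh.sub_diag 0 (by omega)⟩
  have h1 : leftKernel h 1 = 0 := by simp [leftKernel_succ, h0]
  rw [h1, mul_zero, sub_zero] at this
  rcases hh.zero_or_one 1 1 with h2 | h2 <;> simp [h2] at this

lemma leftKernel_one (hh : IsAcuteHessenberg n h B) (hn : 2 ≤ n) : leftKernel h 1 = -1 := by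
  simp [leftKernel_succ, leftKernel, hh.zero_zero hn]

/-- The entries on and above the diagonal are governed by the signs of `leftKernel h`. -/
lemma eq_one_iff (hh : IsAcuteHessenberg n h B) (hn : 2 ≤ n) {j : ℕ} (hj : j < n) :
    ∀ i ≤ j, h i j = 1 ↔ ¬(0 < leftKernel h i ↔ 0 < leftKernel h (j + 1)) := by
  have h00 := hh.zero_zero hn
  have hv1 := hh.leftKernel_one hn
  have hv0 : leftKernel h 0 = 1 := by simp [leftKernel]
  rcases Nat.eq_zero_or_pos j with rfl | hjpos
  · intro i hi
    obtain rfl : i = 0 := by omega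
    simp [h00, hv0, hv1]
  obtain ⟨c, hc⟩ := hh.exists_residual hj
  have hI : ∀ i ≤ j, h i j - c * leftKernel h i ∈ Set.Ioo (0 : ℝ) 1 := by
    intro i hi
    refine hc i hi ?_
    cases i with
    | zero => exact ⟨0, hjpos, h00⟩
    | succ i => exact ⟨i, by omega, hh.sub_diag i (by omega)⟩
  have hone : ∀ i ≤ j, h i j = 1 → 0 < c * leftKernel h i := fun i hi h1 => by
    have := (hI i hi).2; rw [h1] at this; linarith
  have hzero : ∀ i ≤ j, h i j = 0 → c * leftKernel h i < 0 := fun i hi h1 => by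
    have := (hI i hi).1; rw [h1] at this; linarith
  have hnext : c * leftKernel h (j + 1) < 0 := by
    rw [leftKernel_succ, mul_neg, neg_lt_zero, mul_sum]
    obtain ⟨m, hm, hm1⟩ : ∃ m ≤ j, h m j = 1 := by
      by_contra! hne
      have a0 := hzero 0 (by omega) ((hh.zero_or_one 0 j).resolve_right (hne 0 (by omega)))
      have a1 := hzero 1 (by omega) ((hh.zero_or_one 1 j).resolve_right (hne 1 (by omega)))
      rw [hv0] at a0; rw [hv1] at a1; linarith
    refine sum_pos' (fun i hi => ?_) ⟨m, mem_range.2 (by omega), by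
      simpa [hm1] using hone m hm hm1⟩
    have hi : i ≤ j := by simp at hi; omega
    rcases hh.zero_or_one i j with h0 | h1
    · simp [h0]
    · simpa [h1] using (hone i hi h1).le
  intro i hi
  rcases lt_trichotomy c 0 with hc0 | rfl | hc0
  · have hp : 0 < leftKernel h (j + 1) := by
      by_contra hle; nlinarith [mul_nonneg_of_nonpos_of_nonpos hc0.le (not_lt.1 hle)]
    rcases hh.zero_or_one i j with h0 | h1
    · have : 0 < leftKernel h i := by
        have := hzero i hi h0
        by_contra hle; nlinarith [mul_nonneg_of_nonpos_of_nonpos hc0.le (not_lt.1 hle)]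
      simp [h0, hp, this]
    · have : ¬ 0 < leftKernel h i := fun hlt => by
        have := hone i hi h1; nlinarith [mul_neg_of_neg_of_pos hc0 hlt]
      simp [h1, hp]; simpa using this
  · simp at hnext
  · have hp : ¬ 0 < leftKernel h (j + 1) := fun hlt => by nlinarith [mul_pos hc0 hlt]
    rcases hh.zero_or_one i j with h0 | h1
    · have : ¬ 0 < leftKernel h i := fun hlt => by
        have := hzero i hi h0; nlinarith [mul_pos hc0 hlt]
      simp only [h0, hp, this]; simp
    · have : 0 < leftKernel h i := (pos_iff_pos_of_mul_pos (hone i hi h1)).1 hc0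
      simp only [h1, hp, this]; simp

end IsAcuteHessenberg

/-- The `n × n` Hessenberg pattern determined by a sequence of signs. -/
def signPattern (n : ℕ) (s : ℕ → Bool) : Matrix (Fin n) (Fin n) ℝ :=
  Matrix.of fun i j =>
    if (i : ℕ) = j + 1 ∨ ((i : ℕ) ≤ j ∧ s i ≠ s (j + 1)) then 1 else 0

/-- The last diagonal entry of an acute Hessenberg matrix is `1`. -/
lemma RepresentsAcute.last_diag {n : ℕ} (hn : 2 ≤ n) {H : Matrix (Fin n) (Fin n) ℝ}
    (h01 : ZeroOneEntries H) (hH : IsUnreducedUpperHessenberg H) (hinv : IsUnit H.det)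
    (hacute : RepresentsAcute H) (h00 : H ⟨0, by omega⟩ ⟨0, by omega⟩ = 1) :
    H ⟨n - 1, by omega⟩ ⟨n - 1, by omega⟩ = 1 := by
  refine (h01 _ _).resolve_left fun h0 => ?_
  obtain ⟨hdet, hneg, hpos⟩ := hacute
  set B := (Hᵀ * H)⁻¹ with hB
  have hsymm : ∀ i j, B i j = B j i := fun i j => by
    have : Bᵀ = B := by rw [hB, transpose_nonsing_inv, transpose_mul, transpose_transpose]
    exact congrFun (congrFun this j) i
  set z : Fin n := ⟨0, by omega⟩ with hz
  set a : Fin n := ⟨n - 1, by omega⟩ with ha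
  set b : Fin n := ⟨n - 2, by omega⟩ with hb
  have hrow : ∀ j, H a j = if j = b then 1 else 0 := by
    intro j
    split_ifs with hj
    · have := hH.2 b (by simp [hb]; omega)
      subst hj
      convert this using 2
      ext; simp [ha, hb]; omega
    · by_cases hja : j = a
      · rw [hja, h0]
      · refine hH.1 _ _ ?_
        simp [Fin.ext_iff, ha, hb] at hj hja ⊢
        omega
  have hHa : Hᵀ *ᵥ Pi.single a 1 = Pi.single b 1 := by
    ext j
    simp [hrow, Pi.single_apply]
  have hHB : H *ᵥ (B *ᵥ Pi.single b 1) = Pi.single a 1 := by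
    have hinj : Function.Injective (Hᵀ).mulVec :=
      Matrix.mulVec_injective_iff_isUnit.2
        ((Matrix.isUnit_iff_isUnit_det _).2 (by rwa [det_transpose]))
    apply hinj
    rw [hHa, mulVec_mulVec, mulVec_mulVec, hB, Matrix.mul_nonsing_inv _ hdet, one_mulVec]
  have hzero : ∑ j, H z j * B b j = 0 := by
    have := congrFun hHB z
    rw [Pi.single_eq_of_ne (by simp [Fin.ext_iff, hz, ha]; omega)] at this
    rw [mulVec_single_one] at this
    simpa [mulVec, dotProduct, hsymm b] using this
  rcases h01 z b with hzb | hzb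
  · refine (Finset.sum_neg' (fun j _ => ?_) ⟨z, Finset.mem_univ _, ?_⟩ :
      ∑ j, H z j * B b j < 0).ne hzero
    · rcases h01 z j with h | h
      · simp [h]
      · have : b ≠ j := by rintro rfl; rw [h] at hzb; norm_num at hzb
        simpa [h] using (hneg b j this).le
    · have : b ≠ z := by rintro h; rw [h, h00] at hzb; norm_num at hzb
      simpa [h00] using hneg b z this
  · have hle : ∑ j, B b j ≤ ∑ j, H z j * B b j := by
      refine Finset.sum_le_sum fun j _ => ?_
      rcases h01 z j with h | h
      · have : b ≠ j := by rintro rfl; rw [h] at hzb; norm_num at hzb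
        simpa [h] using (hneg b j this).le
      · simp [h]
    linarith [hpos b]

/-- An acute unreduced upper Hessenberg matrix is given by a sequence of signs. -/
lemma RepresentsAcute.exists_signPattern {n : ℕ} (hn : 2 ≤ n) {H : Matrix (Fin n) (Fin n) ℝ}
    (h01 : ZeroOneEntries H) (hH : IsUnreducedUpperHessenberg H) (hinv : IsUnit H.det)
    (hacute : RepresentsAcute H) :
    ∃ s : ℕ → Bool, s 0 ≠ s 1 ∧ s (n - 1) ≠ s n ∧ H = signPattern n s := by
  set h : ℕ → ℕ → ℝ := fun i j => if hij : i < n ∧ j < n then H ⟨i, hij.1⟩ ⟨j, hij.2⟩ else 0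
    with hh
  set B : ℕ → ℕ → ℝ := fun i j =>
    if hij : i < n ∧ j < n then (Hᵀ * H)⁻¹ ⟨i, hij.1⟩ ⟨j, hij.2⟩ else 0 with hB
  have hval : ∀ i j : Fin n, h i j = H i j := fun i j => by simp [hh]
  have hBval : ∀ i j : Fin n, B i j = (Hᵀ * H)⁻¹ i j := fun i j => by simp [hB]
  have key : IsAcuteHessenberg n h B :=
    { zero_or_one := fun i j => by
        simp only [hh]; split_ifs
        · exact h01 _ _
        · exact Or.inl rfl
      eq_zero := fun i j hij => by
        simp only [hh]; split_ifs
        · exact hH.1 _ _ hij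
        · rfl
      sub_diag := fun j hj => by
        simp only [hh]; rw [dif_pos ⟨hj, by omega⟩]
        exact hH.2 ⟨j, by omega⟩ hj
      acute :=
      { mul_eq := fun i hi l hl => by
          have := congrFun (congrFun (Matrix.nonsing_inv_mul _ hacute.1) ⟨i, hi⟩) ⟨l, hl⟩
          rw [Matrix.mul_apply, Matrix.one_apply] at this
          simp only [Fin.mk.injEq] at this
          rw [← this, ← Fin.sum_univ_eq_sum_range
            (fun j => B i j * ∑ m ∈ range n, h m j * h m l)]
          refine Finset.sum_congr rfl fun j _ => ?_
          rw [← hBval, Matrix.mul_apply, ← Fin.sum_univ_eq_sum_range (fun m => h m j * h m l)]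
          congr 1
          refine Finset.sum_congr rfl fun m _ => ?_
          rw [transpose_apply, ← hval, ← hval]
        neg := fun i hi j hj hij => by
          have := hacute.2.1 ⟨i, hi⟩ ⟨j, hj⟩ (by simpa using hij)
          rwa [← hBval] at this
        sum_pos := fun i hi => by
          have := hacute.2.2 ⟨i, hi⟩
          simp only [← hBval] at this
          rwa [Fin.sum_univ_eq_sum_range (fun j => B i j)] at this } }
  have hlast : h (n - 1) (n - 1) = 1 := by
    have h00 := key.zero_zero hn
    rw [← hacute.last_diag hn h01 hH hinv (by rw [← h00, ← hval]), ← hval]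
  refine ⟨fun i => decide (0 < leftKernel h i), ?_, ?_, ?_⟩
  · simp [key.leftKernel_one hn, show leftKernel h 0 = 1 by simp [leftKernel]]
  · have := (key.eq_one_iff hn (j := n - 1) (by omega) (n - 1) le_rfl).1 hlast
    rw [Nat.sub_add_cancel (by omega)] at this
    simpa using this
  · ext i j
    simp only [signPattern, of_apply, ne_eq, decide_eq_decide]
    rw [← hval]
    split_ifs with hc
    · rcases hc with hc | ⟨hle, hc⟩
      · rw [hc]; exact key.sub_diag j (by omega)
      · exact (key.eq_one_iff hn j.2 i hle).2 hc
    · rw [not_or] at hc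
      rcases le_or_gt (i : ℕ) j with hle | hlt
      · refine (key.zero_or_one i j).resolve_right fun h1 => hc.2 ⟨hle, ?_⟩
        exact (key.eq_one_iff hn j.2 i hle).1 h1
      · exact key.eq_zero i j (by omega)

/-- Exchanging the first two signs exchanges the first two rows of the pattern. -/
lemma signPattern_swap_rows {n : ℕ} (hn : 2 ≤ n) {s : ℕ → Bool} (hs : s 0 ≠ s 1) :
    signPattern n s = (signPattern n (s ∘ Equiv.swap 0 1)).submatrix
      (Equiv.swap (⟨0, by omega⟩ : Fin n) ⟨1, by omega⟩) id := by
  ext ⟨i, hi⟩ ⟨j, hj⟩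
  rcases i with _ | _ | i
  · rw [submatrix_apply, Equiv.swap_apply_left]
    rcases j with _ | j
    · simp [signPattern, hs]
    · rw [id]
      simp [signPattern, Equiv.swap_apply_of_ne_of_ne]
  · rw [submatrix_apply, Equiv.swap_apply_right]
    rcases j with _ | j
    · simp [signPattern, hs.symm]
    · rw [id]
      simp [signPattern, Equiv.swap_apply_of_ne_of_ne]
  · rw [submatrix_apply, Equiv.swap_apply_of_ne_of_ne (by simp) (by simp)]
    rcases j with _ | j
    · simp [signPattern]
    · simp [signPattern, Equiv.swap_apply_of_ne_of_ne]

/-- Exchanging the last two signs exchanges the last two columns of the pattern. -/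
lemma signPattern_swap_cols {n : ℕ} (hn : 2 ≤ n) {s : ℕ → Bool} (hs : s (n - 1) ≠ s n) :
    signPattern n s = (signPattern n (s ∘ Equiv.swap (n - 1) n)).submatrix id
      (Equiv.swap (⟨n - 2, by omega⟩ : Fin n) ⟨n - 1, by omega⟩) := by
  obtain ⟨m, rfl⟩ := Nat.exists_eq_add_of_le' hn
  ext ⟨i, hi⟩ ⟨j, hj⟩
  simp only [Nat.add_sub_cancel, show m + 2 - 1 = m + 1 by omega] at hs ⊢
  rw [submatrix_apply, id]
  rcases (by omega : j < m ∨ j = m ∨ j = m + 1) with h | rfl | rfl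
  · rw [Equiv.swap_apply_of_ne_of_ne (by simp; omega) (by simp; omega)]
    have h1 : Equiv.swap (m + 1) (m + 2) (j + 1) = j + 1 :=
      Equiv.swap_apply_of_ne_of_ne (by omega) (by omega)
    rcases (by omega : i ≤ m ∨ i = m + 1) with h' | rfl
    · have h2 : Equiv.swap (m + 1) (m + 2) i = i :=
        Equiv.swap_apply_of_ne_of_ne (by omega) (by omega)
      simp [signPattern, h1, h2]
    · have e1 : ¬ (m + 1 ≤ j) := by omega
      have e2 : ¬ (m = j) := by omega
      simp [signPattern, e1, e2]
  · rw [Equiv.swap_apply_left]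
    rcases (by omega : i ≤ j ∨ i = j + 1) with h' | rfl
    · have h2 : Equiv.swap (j + 1) (j + 2) i = i :=
        Equiv.swap_apply_of_ne_of_ne (by omega) (by omega)
      have e1 : i ≠ j + 1 := by omega
      have e2 : i ≠ j + 2 := by omega
      have e3 : i ≤ j + 1 := by omega
      simp [signPattern, h2, e1, e2, e3, h']
    · simp [signPattern, hs.symm]
  · rw [Equiv.swap_apply_right]
    rcases (by omega : i ≤ m ∨ i = m + 1) with h' | rfl
    · have h2 : Equiv.swap (m + 1) (m + 2) i = i :=
        Equiv.swap_apply_of_ne_of_ne (by omega) (by omega)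
      have e1 : i ≠ m + 1 := by omega
      have e2 : i ≠ m + 2 := by omega
      have e3 : i ≤ m + 1 := by omega
      simp [signPattern, h2, e1, e2, e3, h']
    · simp [signPattern, hs]

/-- The number of sign changes among `s 0, …, s c`. -/
def signChanges (s : ℕ → Bool) (c : ℕ) : ℕ :=
  #{i ∈ range c | s i ≠ s (i + 1)}

section signChanges

variable {s : ℕ → Bool}

lemma signChanges_succ (c : ℕ) :
    signChanges s (c + 1) = signChanges s c + if s c ≠ s (c + 1) then 1 else 0 := by
  rw [signChanges, range_add_one, filter_insert]
  split_ifs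
  · rw [card_insert_of_notMem (by simp), signChanges]
  · rw [signChanges, add_zero]

lemma monotone_signChanges : Monotone (signChanges s) :=
  monotone_nat_of_le_succ fun c => by rw [signChanges_succ]; omega

lemma signChanges_mod_two (c : ℕ) : signChanges s c % 2 = 0 ↔ s c = s 0 := by
  induction c with
  | zero => simp [signChanges]
  | succ c ih =>
    rw [signChanges_succ]
    cases h0 : s 0 <;> cases h1 : s c <;> cases h2 : s (c + 1) <;> simp_all <;> omega

lemma exists_signChanges_eq {m t : ℕ} (ht : t ≤ signChanges s m) :
    ∃ c ≤ m, signChanges s c = t := by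
  induction m with
  | zero => exact ⟨0, le_rfl, by simp [signChanges] at ht ⊢; omega⟩
  | succ m ih =>
    rcases (by omega : t = signChanges s (m + 1) ∨ t < signChanges s (m + 1)) with h | h
    · exact ⟨m + 1, le_rfl, h.symm⟩
    · obtain ⟨c, hc, hct⟩ := ih (by rw [signChanges_succ] at h; split_ifs at h <;> omega)
      exact ⟨c, by omega, hct⟩

end signChanges

/-- The lengths of the runs between consecutive sign changes are those of a composition whose
pattern `Hmat` is the given sign pattern. -/
lemma exists_composition {n : ℕ} (hn : 3 ≤ n) {s : ℕ → Bool} (h01 : s 0 ≠ s 1)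
    (h12 : s 1 = s 2) (hlast : s (n - 2) = s (n - 1)) (hn' : s (n - 1) ≠ s n) :
    ∃ (k : ℕ) (lam : Fin (k + 1) → ℕ),
      (∀ i, 0 < lam i) ∧ (∑ i, lam i = n - 1) ∧ 2 ≤ lam 0 ∧ 2 ≤ lam (Fin.last k) ∧
      signPattern n s = Hmat n (k + 1) lam := by
  have hS0 : signChanges s 0 = 0 := by simp [signChanges]
  have hS1 : signChanges s 1 = 1 := by rw [signChanges_succ 0, hS0, if_pos h01]
  have hS2 : signChanges s 2 = 1 := by rw [signChanges_succ 1, hS1, if_neg (by simpa using h12)]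
  have hmono := monotone_signChanges (s := s)
  have hpos : ∀ c, 1 ≤ c → 1 ≤ signChanges s c := fun c hc => hS1 ▸ hmono hc
  obtain ⟨k, hk⟩ : ∃ k, signChanges s (n - 1) = k + 1 :=
    ⟨signChanges s (n - 1) - 1, by have := hpos (n - 1) (by omega); omega⟩
  have hk2 : signChanges s (n - 2) = k + 1 := by
    have := signChanges_succ (s := s) (n - 2)
    rw [show n - 2 + 1 = n - 1 by omega, hk, if_neg (by simpa using hlast)] at this
    omega
  have hSn : signChanges s n = k + 2 := by
    have := signChanges_succ (s := s) (n - 1)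
    rwa [show n - 1 + 1 = n by omega, hk, if_pos hn'] at this
  have hle : ∀ c ≤ n - 1, signChanges s c ≤ k + 1 := fun c hc => hk ▸ hmono hc
  set L : ℕ → ℕ := fun t => #{c ∈ Icc 1 (n - 1) | signChanges s c = t + 1} with hL
  have hpartial : ∀ t, ∑ u ∈ range t, L u = #{c ∈ Icc 1 (n - 1) | signChanges s c ≤ t} := by
    intro t
    induction t with
    | zero =>
      rw [sum_range_zero, eq_comm, card_eq_zero, filter_eq_empty_iff]
      intro c hc
      have := hpos c (mem_Icc.1 hc).1
      omega
    | succ t ih =>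
      rw [sum_range_succ, ih, hL, ← card_union_of_disjoint, ← filter_or]
      · congr 1
        exact filter_congr fun c _ => by omega
      · exact disjoint_filter.2 fun c _ _ => by omega
  have hcompare : ∀ c ≤ n - 1, ∀ t,
      #{c' ∈ Icc 1 (n - 1) | signChanges s c' ≤ t} < c ↔ t < signChanges s c := by
    intro c hc t
    constructor
    · intro h
      by_contra! hct
      have : Icc 1 c ⊆ {c' ∈ Icc 1 (n - 1) | signChanges s c' ≤ t} := fun d hd => by
        rw [mem_Icc] at hd
        exact mem_filter.2 ⟨mem_Icc.2 ⟨hd.1, by omega⟩, (hmono hd.2).trans hct⟩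
      have := card_le_card this
      rw [Nat.card_Icc] at this
      omega
    · intro h
      have hc0 : c ≠ 0 := by rintro rfl; omega
      have : {c' ∈ Icc 1 (n - 1) | signChanges s c' ≤ t} ⊆ Icc 1 (c - 1) := fun d hd => by
        rw [mem_filter, mem_Icc] at hd
        have : d < c := by
          by_contra! hcd
          have := hmono hcd
          omega
        exact mem_Icc.2 ⟨hd.1.1, by omega⟩
      have := card_le_card this
      rw [Nat.card_Icc] at this
      omega
  have hbeta : ∀ c ≤ n - 1, #{t ∈ range (k + 1) |
      (∑ u : Fin (k + 1), if (u : ℕ) < t then L u else 0) < c} = signChanges s c := by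
    intro c hc
    have : {t ∈ range (k + 1) | (∑ u : Fin (k + 1), if (u : ℕ) < t then L u else 0) < c}
        = range (signChanges s c) := by
      ext t
      rw [mem_filter, mem_range, mem_range,
        Fin.sum_univ_eq_sum_range (fun u => if u < t then L u else 0), ← sum_filter]
      have := hle c hc
      constructor
      · rintro ⟨ht, h⟩
        have hf : {u ∈ range (k + 1) | u < t} = range t := by ext; simp; omega
        rwa [hf, hpartial, hcompare c hc] at h
      · intro ht
        have hf : {u ∈ range (k + 1) | u < t} = range t := by ext; simp; omega
        rw [hf, hpartial, hcompare c hc]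
        exact ⟨by omega, ht⟩
    rw [this, card_range]
  have htwo : ∀ a b t, 1 ≤ a → a < b → b ≤ n - 1 → signChanges s a = t + 1 →
      signChanges s b = t + 1 → 2 ≤ L t := by
    intro a b t ha hab hb hSa hSb
    rw [hL, ← card_pair hab.ne]
    refine card_le_card fun c hc => ?_
    rw [mem_filter, mem_Icc]
    rcases mem_insert.1 hc with rfl | hc
    · exact ⟨⟨ha, by omega⟩, hSa⟩
    · rw [mem_singleton.1 hc]
      exact ⟨⟨by omega, hb⟩, hSb⟩
  refine ⟨k, fun i => L i, fun i => ?_, ?_, ?_, ?_, ?_⟩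
  · obtain ⟨c, hc, hct⟩ := exists_signChanges_eq (s := s) (m := n - 1) (t := i + 1) (by omega)
    refine card_pos.2 ⟨c, mem_filter.2 ⟨mem_Icc.2 ⟨?_, hc⟩, hct⟩⟩
    by_contra h
    obtain rfl : c = 0 := by omega
    omega
  · rw [Fin.sum_univ_eq_sum_range, hpartial, filter_true_of_mem, Nat.card_Icc]
    · omega
    · exact fun c hc => hle c (mem_Icc.1 hc).2
  · exact htwo 1 2 0 le_rfl (by omega) (by omega) hS1 hS2
  · refine htwo (n - 2) (n - 1) k ?_ (by omega) le_rfl hk2 hk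
    omega
  · ext ⟨i, hi⟩ ⟨j, hj⟩
    have hrow : (if i + 1 = 1 then 0 else signChanges s (i + 1 - 1)) = signChanges s i := by
      cases i <;> simp [hS0]
    have hcol : (if j + 1 ≤ n - 1 then signChanges s (j + 1) else k + 1 + 1)
        = signChanges s (j + 1) := by
      split_ifs with h
      · rfl
      · rw [show j + 1 = n by omega, hSn]
    simp only [signPattern, Hmat, of_apply]
    rw [hbeta (i + 1 - 1) (by omega), hrow]
    have hcol' : (if j + 1 ≤ n - 1 then #{t ∈ range (k + 1) |
        (∑ u : Fin (k + 1), if (u : ℕ) < t then L u else 0) < j + 1} else k + 1 + 1)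
        = signChanges s (j + 1) := by
      rw [← hcol]
      split_ifs with h
      · exact hbeta _ h
      · rfl
    rw [hcol']
    refine if_congr (or_congr_right' fun hij => ?_) rfl rfl
    have hi2 := signChanges_mod_two (s := s) i
    have hj2 := signChanges_mod_two (s := s) (j + 1)
    have hne : s i ≠ s (j + 1) ↔ signChanges s i % 2 ≠ signChanges s (j + 1) % 2 := by
      cases h0 : s 0 <;> cases h1 : s i <;> cases h2 : s (j + 1) <;>
        simp only [h0, h1, h2, reduceCtorEq, iff_true, iff_false, ne_eq, not_true_eq_false,
          not_false_eq_true, true_iff, false_iff, not_not] at hi2 hj2 ⊢ <;> omega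
    rw [hne]
    rcases le_or_gt i (j + 1) with h | h
    · have := hmono h
      omega
    · have := hmono h.le
      omega

/-- If an `n × n` unreduced upper Hessenberg 0/1-matrix represents an acute 0/1-simplex,
then it equals `H_λ` for some composition `λ` of `n - 1` with first and last parts at
least `2`, possibly after exchanging the first two rows and/or the last two columns. -/
theorem uuh_acute_eq_Hmat (n : ℕ) (hn : 3 ≤ n) (H : Matrix (Fin n) (Fin n) ℝ)
    (h01 : ZeroOneEntries H) (hH : IsUnreducedUpperHessenberg H)
    (hinv : IsUnit H.det) (hacute : RepresentsAcute H) :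
    ∃ (k : ℕ) (lam : Fin (k + 1) → ℕ),
      (∀ i, 0 < lam i) ∧ (∑ i, lam i = n - 1) ∧ 2 ≤ lam 0 ∧ 2 ≤ lam (Fin.last k) ∧
      ∃ b c : Bool,
        H = (Hmat n (k + 1) lam).submatrix
          (fun i => if b then Equiv.swap (⟨0, by omega⟩ : Fin n) ⟨1, by omega⟩ i else i)
          (fun j => if c then Equiv.swap (⟨n - 2, by omega⟩ : Fin n) ⟨n - 1, by omega⟩ j else j) := by
  obtain ⟨s, hs01, hsn, rfl⟩ := hacute.exists_signPattern (by omega) h01 hH hinv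
  obtain ⟨b, s₁, h01', h12, hn', hrows⟩ : ∃ (b : Bool) (s₁ : ℕ → Bool), s₁ 0 ≠ s₁ 1 ∧
      s₁ 1 = s₁ 2 ∧ s₁ (n - 1) ≠ s₁ n ∧ signPattern n s = (signPattern n s₁).submatrix
        (fun i => if b then Equiv.swap (⟨0, by omega⟩ : Fin n) ⟨1, by omega⟩ i else i) id := by
    by_cases h : s 1 = s 2
    · exact ⟨false, s, hs01, h, hsn, rfl⟩
    · have hfix : ∀ m, 2 ≤ m → Equiv.swap 0 1 m = m := fun m hm =>
        Equiv.swap_apply_of_ne_of_ne (by omega) (by omega)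
      refine ⟨true, s ∘ Equiv.swap 0 1, ?_, ?_, ?_, signPattern_swap_rows (by omega) hs01⟩
      · simpa using hs01.symm
      · rw [Function.comp_apply, Function.comp_apply, hfix 2 le_rfl, Equiv.swap_apply_right]
        cases h0 : s 0 <;> cases h1 : s 1 <;> cases h2 : s 2 <;> simp_all
      · rwa [Function.comp_apply, Function.comp_apply, hfix n (by omega), hfix _ (by omega)]
  obtain ⟨c, s₂, h01'', h12', hlast, hn'', hcols⟩ : ∃ (c : Bool) (s₂ : ℕ → Bool),
      s₂ 0 ≠ s₂ 1 ∧ s₂ 1 = s₂ 2 ∧ s₂ (n - 2) = s₂ (n - 1) ∧ s₂ (n - 1) ≠ s₂ n ∧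
      signPattern n s₁ = (signPattern n s₂).submatrix id (fun j =>
        if c then Equiv.swap (⟨n - 2, by omega⟩ : Fin n) ⟨n - 1, by omega⟩ j else j) := by
    by_cases h : s₁ (n - 2) = s₁ (n - 1)
    · exact ⟨false, s₁, h01', h12, h, hn', rfl⟩
    · have hn4 : 4 ≤ n := by
        by_contra hlt
        obtain rfl : n = 3 := by omega
        exact h h12
      have hfix : ∀ m, m < n - 1 → Equiv.swap (n - 1) n m = m := fun m hm =>
        Equiv.swap_apply_of_ne_of_ne (by omega) (by omega)
      refine ⟨true, s₁ ∘ Equiv.swap (n - 1) n, ?_, ?_, ?_, ?_,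
        signPattern_swap_cols (by omega) hn'⟩
      · rwa [Function.comp_apply, Function.comp_apply, hfix 0 (by omega), hfix 1 (by omega)]
      · rwa [Function.comp_apply, Function.comp_apply, hfix 1 (by omega), hfix 2 (by omega)]
      · rw [Function.comp_apply, Function.comp_apply, hfix (n - 2) (by omega),
          Equiv.swap_apply_left]
        cases h0 : s₁ (n - 2) <;> cases h1 : s₁ (n - 1) <;> cases h2 : s₁ n <;> simp_all
      · simpa using hn'.symm
  obtain ⟨k, lam, hpos, hsum, hfirst, hlast', hpat⟩ :=
    exists_composition hn h01'' h12' hlast hn''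
  refine ⟨k, lam, hpos, hsum, hfirst, hlast', b, c, ?_⟩
  rw [hrows, hcols, hpat]
  rfl
end

section
/- Let H be an n×(n−1) unreduced upper Hessenberg matrix with entries in {0,1} that represents an acute 0/1-simplex. Then there exist at most two (n+1)×n unreduced upper Hessenberg matrices with entries in {0,1} that represent an acute 0/1-simplex and whose top-left n×(n−1) submatrix equals H. -/
open Matrix BigOperators

/-- The last row of the inverse Gramian of an acute 0/1-simplex `P` is a vector `x` whose
image `P *ᵥ x` is orthogonal to all columns but the last, and the signs of the entries of
`P *ᵥ x` encode the last column of `P`. -/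
theorem RepresentsAcute.exists_signed_normal {m n : ℕ} {P : Matrix (Fin m) (Fin (n + 1)) ℝ}
    (h01 : ZeroOneEntries P) (hP : RepresentsAcute P) :
    ∃ x : Fin (n + 1) → ℝ, (∀ j : Fin n, x j.castSucc < 0) ∧
      (∀ j : Fin n, ∑ i, (P *ᵥ x) i * P i j.castSucc = 0) ∧
      (∀ i, P i (Fin.last n) = 1 → 0 < (P *ᵥ x) i) ∧
      (∀ i, P i (Fin.last n) = 0 → (P *ᵥ x) i ≤ 0) := by
  obtain ⟨hdet, hneg, hsum⟩ := hP
  set x : Fin (n + 1) → ℝ := (Pᵀ * P)⁻¹ (Fin.last n) with hx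
  have hxneg : ∀ j, j ≠ Fin.last n → x j < 0 := fun j hj => hneg _ _ hj.symm
  refine ⟨x, fun j => hxneg _ (Fin.castSucc_lt_last j).ne, fun j => ?_, fun i hi => ?_,
    fun i hi => ?_⟩
  · have h : (x ᵥ* (Pᵀ * P)) j.castSucc = 0 := by
      have h' := congrFun (congrFun (Matrix.nonsing_inv_mul (Pᵀ * P) hdet) (Fin.last n))
        j.castSucc
      rwa [Matrix.one_apply_ne (Fin.castSucc_lt_last j).ne'] at h'
    rw [← Matrix.vecMul_vecMul, Matrix.vecMul_transpose] at h
    exact h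
  · refine (hsum (Fin.last n)).trans_le (Finset.sum_le_sum fun j _ => ?_)
    change x j ≤ P i j * x j
    by_cases hj : j = Fin.last n
    · rw [hj, hi, one_mul]
    · have := hxneg j hj
      rcases h01 i j with h | h <;> rw [h] <;> linarith
  · change ∑ j, P i j * x j ≤ 0
    refine Finset.sum_nonpos fun j _ => ?_
    by_cases hj : j = Fin.last n
    · rw [hj, hi, zero_mul]
    · have := hxneg j hj
      rcases h01 i j with h | h <;> rw [h] <;> linarith

/-- A vector orthogonal to the columns of an unreduced upper Hessenberg matrix with one more
row than columns vanishes as soon as its first entry does. -/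
theorem IsUnreducedUpperHessenberg.eq_zero_of_orthogonal {n : ℕ}
    {H : Matrix (Fin (n + 1)) (Fin n) ℝ} (hH : IsUnreducedUpperHessenberg H)
    {y : Fin (n + 1) → ℝ} (hy : ∀ j, ∑ i, y i * H i j = 0) (h0 : y 0 = 0) : y = 0 := by
  have key : ∀ k (hk : k < n + 1), y ⟨k, hk⟩ = 0 := by
    intro k
    induction k using Nat.strong_induction_on with
    | _ k ih =>
      intro hk
      rcases k with _ | k
      · exact h0
      · have h := hy ⟨k, by omega⟩
        rw [Finset.sum_eq_single ⟨k + 1, hk⟩] at h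
        · rwa [hH.2 ⟨k, by omega⟩ hk, mul_one] at h
        · intro i _ hi
          have hne : (i : ℕ) ≠ k + 1 := fun e => hi (Fin.ext e)
          rcases lt_or_gt_of_ne hne with hlt | hgt
          · rw [ih i hlt i.isLt, zero_mul]
          · rw [hH.1 i _ hgt, mul_zero]
        · simp
  exact funext fun i => key i i.isLt

/-- The last row of an extension of `H` vanishes except for a final `1`. -/
theorem IsUnreducedUpperHessenberg.last_row {n : ℕ}
    {M : Matrix (Fin (n + 2)) (Fin (n + 1)) ℝ} (hM : IsUnreducedUpperHessenberg M) (j : Fin n) :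
    M (Fin.last (n + 1)) j.castSucc = 0 :=
  hM.1 _ _ (by simp)

/-- The last column of an acute unreduced upper Hessenberg extension of `H` is read off from
the signs of a vector orthogonal to the columns of `H`, with nonzero first entry if `H` has
any columns. -/
theorem exists_orthogonal_of_extension {n : ℕ} {H : Matrix (Fin (n + 1)) (Fin n) ℝ}
    (hH : IsUnreducedUpperHessenberg H) {M : Matrix (Fin (n + 2)) (Fin (n + 1)) ℝ}
    (h01 : ZeroOneEntries M) (hM : IsUnreducedUpperHessenberg M) (hacute : RepresentsAcute M)
    (hMH : ∀ (i : Fin (n + 1)) (j : Fin n), M i.castSucc j.castSucc = H i j) :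
    ∃ y : Fin (n + 1) → ℝ, (∀ j, ∑ i, y i * H i j = 0) ∧ (0 < n → y 0 ≠ 0) ∧
      (∀ i, M i.castSucc (Fin.last n) = 1 → 0 < y i) ∧
      (∀ i, M i.castSucc (Fin.last n) = 0 → y i ≤ 0) := by
  obtain ⟨x, hx, horth, hpos, hnonpos⟩ := hacute.exists_signed_normal h01
  have hker : ∀ j, ∑ i : Fin (n + 1), (M *ᵥ x) i.castSucc * H i j = 0 := by
    intro j
    have h := horth j
    rw [Fin.sum_univ_castSucc, hM.last_row, mul_zero, add_zero] at h
    simpa only [hMH] using h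
  refine ⟨fun i => (M *ᵥ x) i.castSucc, hker, fun hn h0 => ?_, fun i => hpos _,
    fun i => hnonpos _⟩
  have hzero := hH.eq_zero_of_orthogonal hker h0
  obtain ⟨k, rfl⟩ : ∃ k, n = k + 1 := ⟨n - 1, by omega⟩
  have hlast : (M *ᵥ x) (Fin.last (k + 1)).castSucc = 0 := congrFun hzero _
  have hv : M (Fin.last (k + 1)).castSucc (Fin.last (k + 1)) = 0 := by
    refine (h01 _ _).resolve_right fun h => ?_
    exact (hpos _ h).ne' hlast
  have hsum : (M *ᵥ x) (Fin.last (k + 1)).castSucc = x (Fin.last k).castSucc := by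
    change ∑ j, M (Fin.last (k + 1)).castSucc j * x j = _
    rw [Fin.sum_univ_castSucc, hv, zero_mul, add_zero, Finset.sum_eq_single (Fin.last k)]
    · rw [hMH, show H (Fin.last (k + 1)) (Fin.last k) = 1 from hH.2 (Fin.last k) (by simp),
        one_mul]
    · intro j _ hj
      have : (j : ℕ) < k := Fin.val_lt_last hj
      rw [hMH, hH.1 _ _ (by simpa using this), zero_mul]
    · simp
  have := hx (Fin.last k)
  linarith

/-- An acute unreduced upper Hessenberg extension of `H` is determined by the first entry of
its last column. -/
theorem extension_eq_of_corner_eq {n : ℕ} {H : Matrix (Fin (n + 1)) (Fin n) ℝ}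
    (hH : IsUnreducedUpperHessenberg H) {M N : Matrix (Fin (n + 2)) (Fin (n + 1)) ℝ}
    (h01M : ZeroOneEntries M) (hM : IsUnreducedUpperHessenberg M) (hacuteM : RepresentsAcute M)
    (hMH : ∀ (i : Fin (n + 1)) (j : Fin n), M i.castSucc j.castSucc = H i j)
    (h01N : ZeroOneEntries N) (hN : IsUnreducedUpperHessenberg N) (hacuteN : RepresentsAcute N)
    (hNH : ∀ (i : Fin (n + 1)) (j : Fin n), N i.castSucc j.castSucc = H i j)
    (hcorner : M 0 (Fin.last n) = N 0 (Fin.last n)) : M = N := by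
  have hcol : ∀ i : Fin (n + 1), M i.castSucc (Fin.last n) = N i.castSucc (Fin.last n) := by
    rcases Nat.eq_zero_or_pos n with rfl | hn
    · intro i
      rw [Fin.fin_one_eq_zero i]
      exact hcorner
    obtain ⟨y, hy, hy0, hypos, hynonpos⟩ :=
      exists_orthogonal_of_extension hH h01M hM hacuteM hMH
    obtain ⟨z, hz, hz0, hzpos, hznonpos⟩ :=
      exists_orthogonal_of_extension hH h01N hN hacuteN hNH
    have hprop : ∀ i, z 0 * y i = y 0 * z i := by
      have h := hH.eq_zero_of_orthogonal (y := fun i => z 0 * y i - y 0 * z i)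
        (fun j => by
          simp only [sub_mul, mul_assoc, Finset.sum_sub_distrib, ← Finset.mul_sum, hy, hz]
          ring) (by ring)
      exact fun i => sub_eq_zero.mp (congrFun h i)
    have hsign : 0 < z 0 * y 0 := by
      rcases h01M 0 (Fin.last n) with h | h
      · have h1 := lt_of_le_of_ne (hynonpos 0 h) (hy0 hn)
        have h2 := lt_of_le_of_ne (hznonpos 0 (hcorner ▸ h)) (hz0 hn)
        exact mul_pos_of_neg_of_neg h2 h1
      · exact mul_pos (hzpos 0 (hcorner ▸ h)) (hypos 0 h)
    have hiff : ∀ i, 0 < y i ↔ 0 < z i := by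
      intro i
      have h1 : (z 0 * y 0) * y i = y 0 ^ 2 * z i := by linear_combination y 0 * hprop i
      have h2 : 0 < y 0 ^ 2 := by have := hy0 hn; positivity
      rw [← mul_pos_iff_of_pos_left hsign, h1, mul_pos_iff_of_pos_left h2]
    intro i
    rcases h01M i.castSucc (Fin.last n) with h | h <;>
      rcases h01N i.castSucc (Fin.last n) with h' | h'
    · rw [h, h']
    · exact absurd ((hiff i).2 (hzpos i h')) (hynonpos i h).not_gt
    · exact absurd ((hiff i).1 (hypos i h)) (hznonpos i h').not_gt
    · rw [h, h']
  ext i j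
  induction i using Fin.lastCases with
  | last =>
    induction j using Fin.lastCases with
    | last => exact (hM.2 (Fin.last n) (by simp)).trans (hN.2 (Fin.last n) (by simp)).symm
    | cast j => rw [hM.last_row, hN.last_row]
  | cast i =>
    induction j using Fin.lastCases with
    | last => exact hcol i
    | cast j => rw [hMH, hNH]

/-- If an `(n+1) × n` unreduced upper Hessenberg 0/1-matrix `H` represents an acute
0/1-simplex, then there are at most two `(n+2) × (n+1)` unreduced upper Hessenberg
0/1-matrices representing an acute 0/1-simplex whose top-left `(n+1) × n` submatrix
equals `H`. -/
theorem at_most_two_uuh_extensions (n : ℕ) (H : Matrix (Fin (n + 1)) (Fin n) ℝ)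
    (h01 : ZeroOneEntries H) (hH : IsUnreducedUpperHessenberg H)
    (hacute : RepresentsAcute H) :
    ∃ M₁ M₂ : Matrix (Fin (n + 2)) (Fin (n + 1)) ℝ,
      ∀ M : Matrix (Fin (n + 2)) (Fin (n + 1)) ℝ,
        ZeroOneEntries M → IsUnreducedUpperHessenberg M → RepresentsAcute M →
        (∀ (i : Fin (n + 1)) (j : Fin n), M i.castSucc j.castSucc = H i j) →
        M = M₁ ∨ M = M₂ := by
  have hchoice : ∀ a : ℝ, ∃ M₀ : Matrix (Fin (n + 2)) (Fin (n + 1)) ℝ,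
      ∀ M : Matrix (Fin (n + 2)) (Fin (n + 1)) ℝ,
        ZeroOneEntries M → IsUnreducedUpperHessenberg M → RepresentsAcute M →
        (∀ (i : Fin (n + 1)) (j : Fin n), M i.castSucc j.castSucc = H i j) →
        M 0 (Fin.last n) = a → M = M₀ := by
    intro a
    by_cases hex : ∃ M₀ : Matrix (Fin (n + 2)) (Fin (n + 1)) ℝ,
        ZeroOneEntries M₀ ∧ IsUnreducedUpperHessenberg M₀ ∧ RepresentsAcute M₀ ∧
        (∀ (i : Fin (n + 1)) (j : Fin n), M₀ i.castSucc j.castSucc = H i j) ∧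
        M₀ 0 (Fin.last n) = a
    · obtain ⟨M₀, h1, h2, h3, h4, h5⟩ := hex
      exact ⟨M₀, fun M k1 k2 k3 k4 k5 =>
        extension_eq_of_corner_eq hH k1 k2 k3 k4 h1 h2 h3 h4 (k5.trans h5.symm)⟩
    · exact ⟨0, fun M k1 k2 k3 k4 k5 => absurd ⟨M, k1, k2, k3, k4, k5⟩ hex⟩
  obtain ⟨M₁, h₁⟩ := hchoice 0
  obtain ⟨M₂, h₂⟩ := hchoice 1
  refine ⟨M₁, M₂, fun M k1 k2 k3 k4 => ?_⟩
  rcases k1 0 (Fin.last n) with h | h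
  · exact Or.inl (h₁ M k1 k2 k3 k4 h)
  · exact Or.inr (h₂ M k1 k2 k3 k4 h)
end

section
/- For every n ≥ 3, the number of n×(n−1) unreduced upper Hessenberg matrices with entries in {0,1} that represent an acute 0/1-simplex is at most 2^{n−2}. -/
open Matrix BigOperators

/-- The leading block of an unreduced upper Hessenberg matrix is unreduced upper Hessenberg. -/
lemma IsUnreducedUpperHessenberg.submatrix_castSucc {k : ℕ}
    {H : Matrix (Fin (k + 2)) (Fin (k + 1)) ℝ} (hH : IsUnreducedUpperHessenberg H) :
    IsUnreducedUpperHessenberg (H.submatrix Fin.castSucc Fin.castSucc) :=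
  ⟨fun i j hij => hH.1 i.castSucc j.castSucc hij,
    fun j hj => hH.2 j.castSucc (by have := j.isLt; simp only [Fin.val_castSucc]; omega)⟩

/-- The Gram matrix of the leading block is the leading block of the Gram matrix, provided the
last row vanishes off the last column. -/
lemma transpose_mul_castSucc {k : ℕ} {H : Matrix (Fin (k + 2)) (Fin (k + 1)) ℝ}
    (hH : IsUnreducedUpperHessenberg H) (i : Fin k) (j : Fin (k + 1)) :
    (Hᵀ * H) i.castSucc j = ∑ l : Fin (k + 1), H l.castSucc i.castSucc * H l.castSucc j := by
  have h0 : H (Fin.last (k + 1)) i.castSucc = 0 :=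
    hH.1 _ _ (by have := i.isLt; simp only [Fin.val_castSucc, Fin.val_last]; omega)
  simp [Matrix.mul_apply, Fin.sum_univ_castSucc (n := k + 1), h0]

lemma RepresentsAcute.inv_last_last_pos {m k : ℕ} {H : Matrix (Fin m) (Fin (k + 1)) ℝ}
    (hA : RepresentsAcute H) : 0 < (Hᵀ * H)⁻¹ (Fin.last k) (Fin.last k) := by
  have h1 := hA.2.2 (Fin.last k)
  rw [Fin.sum_univ_castSucc] at h1
  have h2 : ∑ j : Fin k, (Hᵀ * H)⁻¹ (Fin.last k) j.castSucc ≤ 0 :=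
    Finset.sum_nonpos fun j _ => (hA.2.1 _ _ (Fin.castSucc_lt_last j).ne').le
  linarith

/-- The leading block of an acute unreduced upper Hessenberg matrix is acute. -/
lemma RepresentsAcute.submatrix_castSucc {k : ℕ} {H : Matrix (Fin (k + 2)) (Fin (k + 1)) ℝ}
    (hH : IsUnreducedUpperHessenberg H) (hA : RepresentsAcute H) :
    RepresentsAcute (H.submatrix Fin.castSucc Fin.castSucc) := by
  have hβ := hA.inv_last_last_pos
  obtain ⟨hU, hoff, hrow⟩ := hA
  have hGB := Matrix.mul_nonsing_inv _ hU
  have hG := transpose_mul_castSucc hH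
  set B := (Hᵀ * H)⁻¹ with hB
  set P := H.submatrix Fin.castSucc Fin.castSucc with hP
  have hentry : ∀ (i : Fin k) (j : Fin (k + 1)),
      ∑ l : Fin k, (Pᵀ * P) i l * B l.castSucc j + (Hᵀ * H) i.castSucc (Fin.last k) *
        B (Fin.last k) j = (1 : Matrix (Fin (k + 1)) (Fin (k + 1)) ℝ) i.castSucc j := by
    intro i j
    rw [← hGB, Matrix.mul_apply (M := Hᵀ * H), Fin.sum_univ_castSucc]
    congr 1
    refine Finset.sum_congr rfl fun l _ => ?_
    rw [hG i l.castSucc]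
    rfl
  let C : Matrix (Fin k) (Fin k) ℝ := fun i j =>
    B i.castSucc j.castSucc -
      B i.castSucc (Fin.last k) * B (Fin.last k) j.castSucc / B (Fin.last k) (Fin.last k)
  have hGC : Pᵀ * P * C = 1 := by
    ext i j
    have h1 := hentry i j.castSucc
    have h2 := hentry i (Fin.last k)
    rw [Matrix.one_apply_ne (Fin.castSucc_lt_last i).ne] at h2
    have h3 : (1 : Matrix (Fin (k + 1)) (Fin (k + 1)) ℝ) i.castSucc j.castSucc
        = (1 : Matrix (Fin k) (Fin k) ℝ) i j := by
      simp [Matrix.one_apply]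
    rw [h3] at h1
    have h4 : (Pᵀ * P * C) i j = ∑ l : Fin k, (Pᵀ * P) i l * B l.castSucc j.castSucc
        - (∑ l : Fin k, (Pᵀ * P) i l * B l.castSucc (Fin.last k)) *
          (B (Fin.last k) j.castSucc / B (Fin.last k) (Fin.last k)) := by
      rw [Matrix.mul_apply, Finset.sum_mul, ← Finset.sum_sub_distrib]
      refine Finset.sum_congr rfl fun l _ => ?_
      simp only [C]
      ring
    rw [h4, ← h1, eq_neg_of_add_eq_zero_left h2]
    field_simp
    ring
  have hinv : (Pᵀ * P)⁻¹ = C := Matrix.inv_eq_right_inv hGC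
  refine ⟨Matrix.isUnit_det_of_right_inverse hGC, ?_, ?_⟩
  · intro i j hij
    rw [hinv]
    have h1 := hoff i.castSucc j.castSucc (by simpa using hij)
    have h2 := hoff i.castSucc (Fin.last k) (Fin.castSucc_lt_last i).ne
    have h3 := hoff (Fin.last k) j.castSucc (Fin.castSucc_lt_last j).ne'
    have h4 := div_pos (mul_pos_of_neg_of_neg h2 h3) hβ
    simp only [C]
    linarith
  · intro i
    rw [hinv]
    have h1 := hrow i.castSucc
    have h2 := hrow (Fin.last k)
    have h3 := hoff i.castSucc (Fin.last k) (Fin.castSucc_lt_last i).ne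
    rw [Fin.sum_univ_castSucc] at h1 h2
    have h4 : ∑ j, C i j = ∑ j : Fin k, B i.castSucc j.castSucc -
        B i.castSucc (Fin.last k) / B (Fin.last k) (Fin.last k) *
          ∑ j : Fin k, B (Fin.last k) j.castSucc := by
      rw [Finset.mul_sum, ← Finset.sum_sub_distrib]
      refine Finset.sum_congr rfl fun l _ => ?_
      simp only [C]
      ring
    have h5 := mul_neg_of_neg_of_pos (div_neg_of_neg_of_pos h3 hβ) h2
    have h6 : B i.castSucc (Fin.last k) / B (Fin.last k) (Fin.last k) *
        B (Fin.last k) (Fin.last k) = B i.castSucc (Fin.last k) := div_mul_cancel₀ _ hβ.ne'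
    rw [mul_add, h6] at h5
    rw [h4]
    linarith

/-- The orthogonal projection of the last column onto the span of the previous ones lies in the
interior of the simplex spanned by these and the origin. -/
lemma RepresentsAcute.exists_projection {k : ℕ} {H : Matrix (Fin (k + 2)) (Fin (k + 1)) ℝ}
    (hH : IsUnreducedUpperHessenberg H) (hA : RepresentsAcute H) :
    ∃ c : Fin k → ℝ, (∀ j, 0 < c j) ∧ ∑ j, c j < 1 ∧
      ∀ i : Fin k, ∑ l : Fin (k + 1), H l.castSucc i.castSucc *
        (H l.castSucc (Fin.last k) - ∑ j : Fin k, H l.castSucc j.castSucc * c j) = 0 := by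
  have hβ := hA.inv_last_last_pos
  obtain ⟨hU, hoff, hrow⟩ := hA
  have hGB := Matrix.mul_nonsing_inv _ hU
  have hG := transpose_mul_castSucc hH
  have hsymm : ∀ i j, (Hᵀ * H)⁻¹ i j = (Hᵀ * H)⁻¹ j i := by
    intro i j
    have : ((Hᵀ * H)⁻¹)ᵀ = (Hᵀ * H)⁻¹ := by
      rw [Matrix.transpose_nonsing_inv, Matrix.transpose_mul, Matrix.transpose_transpose]
    exact congrFun (congrFun this j) i
  set B := (Hᵀ * H)⁻¹ with hB
  refine ⟨fun j => -B j.castSucc (Fin.last k) / B (Fin.last k) (Fin.last k), ?_, ?_, ?_⟩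
  · intro j
    exact div_pos (neg_pos.2 (hoff _ _ (Fin.castSucc_lt_last j).ne)) hβ
  · have h1 := hrow (Fin.last k)
    rw [Fin.sum_univ_castSucc] at h1
    rw [← Finset.sum_div, div_lt_one hβ, Finset.sum_neg_distrib]
    simp only [hsymm _ (Fin.last k)]
    linarith
  · intro i
    have h1 : (Hᵀ * H * B) i.castSucc (Fin.last k) = 0 := by
      rw [hGB, Matrix.one_apply_ne (Fin.castSucc_lt_last i).ne]
    rw [Matrix.mul_apply, Fin.sum_univ_castSucc] at h1
    have h2 : ∑ l : Fin (k + 1), H l.castSucc i.castSucc *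
        (H l.castSucc (Fin.last k) - ∑ j : Fin k, H l.castSucc j.castSucc *
          (-B j.castSucc (Fin.last k) / B (Fin.last k) (Fin.last k))) =
        (Hᵀ * H) i.castSucc (Fin.last k) + (∑ j : Fin k, (Hᵀ * H) i.castSucc j.castSucc *
          B j.castSucc (Fin.last k)) / B (Fin.last k) (Fin.last k) := by
      simp only [hG, mul_sub, Finset.sum_sub_distrib, Finset.mul_sum, Finset.sum_mul,
        Finset.sum_div]
      rw [sub_eq_add_neg, ← Finset.sum_neg_distrib, Finset.sum_comm]
      congr 1
      refine Finset.sum_congr rfl fun l _ => ?_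
      rw [← Finset.sum_neg_distrib]
      refine Finset.sum_congr rfl fun j _ => ?_
      ring
    rw [h2, eq_neg_of_add_eq_zero_left h1]
    field_simp
    ring

/-- A vector in the left kernel of an unreduced upper Hessenberg matrix whose first coordinate is
zero vanishes. -/
lemma IsUnreducedUpperHessenberg.eq_zero_of_vecMul_eq_zero {k : ℕ}
    {P : Matrix (Fin (k + 1)) (Fin k) ℝ} (hP : IsUnreducedUpperHessenberg P)
    {z : Fin (k + 1) → ℝ} (hz : ∀ i : Fin k, ∑ l, P l i * z l = 0) (h0 : z 0 = 0) (i) :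
    z i = 0 := by
  have key : ∀ n : ℕ, ∀ l : Fin (k + 1), (l : ℕ) = n → z l = 0 := by
    intro n
    induction n using Nat.strong_induction_on with
    | _ n ih =>
      intro l hl
      induction l using Fin.cases with
      | zero => exact h0
      | succ j =>
        have h1 := hz j
        rw [Finset.sum_eq_single j.succ] at h1
        · have h2 : P j.succ j = 1 := hP.2 j (by omega)
          simpa [h2] using h1
        · intro l _ hlj
          rcases lt_or_gt_of_ne hlj with h | h
          · rw [ih l (hl ▸ h) l rfl, mul_zero]
          · rw [hP.1 l j (by simpa [Fin.lt_def] using h), zero_mul]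
        · simp
  exact key _ _ rfl

/-- Every coordinate of an interior point of a 0/1-simplex with a vertex at the origin is
in `[0, 1)`. -/
lemma ZeroOneEntries.sum_mul_mem {m k : ℕ} {P : Matrix (Fin m) (Fin k) ℝ}
    (hP : ZeroOneEntries P) {c : Fin k → ℝ} (hc : ∀ j, 0 < c j) (hs : ∑ j, c j < 1) (i : Fin m) :
    0 ≤ ∑ j, P i j * c j ∧ ∑ j, P i j * c j < 1 := by
  constructor
  · refine Finset.sum_nonneg fun j _ => ?_
    rcases hP i j with h | h <;> simp [h, (hc j).le]
  · refine lt_of_le_of_lt (Finset.sum_le_sum fun j _ => ?_) hs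
    rcases hP i j with h | h <;> simp [h, (hc j).le]

/-- Coordinates belonging to a row with an entry `1` are positive. -/
lemma ZeroOneEntries.sum_mul_pos {m k : ℕ} {P : Matrix (Fin m) (Fin k) ℝ}
    (hP : ZeroOneEntries P) {c : Fin k → ℝ} (hc : ∀ j, 0 < c j) {i : Fin m} {j : Fin k}
    (hij : P i j = 1) : 0 < ∑ j, P i j * c j := by
  refine Finset.sum_pos' (fun j _ => ?_) ⟨j, Finset.mem_univ _, by simp [hij, hc j]⟩
  rcases hP i j with h | h <;> simp [h, (hc j).le]

/-- If `v` and `w` are 0/1-vectors with the same first entry whose projections onto the span of the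
columns of `P` lie in the interior of the simplex, then `v = w`. -/
lemma eq_of_projection {k : ℕ} {P : Matrix (Fin (k + 2)) (Fin (k + 1)) ℝ}
    (hP : IsUnreducedUpperHessenberg P) (hP01 : ZeroOneEntries P)
    {v w : Fin (k + 2) → ℝ} (hv : ∀ i, v i = 0 ∨ v i = 1) (hw : ∀ i, w i = 0 ∨ w i = 1)
    {c d : Fin (k + 1) → ℝ} (hc : ∀ j, 0 < c j) (hcs : ∑ j, c j < 1)
    (hd : ∀ j, 0 < d j) (hds : ∑ j, d j < 1)
    (hvc : ∀ i, ∑ l, P l i * (v l - ∑ j, P l j * c j) = 0)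
    (hwd : ∀ i, ∑ l, P l i * (w l - ∑ j, P l j * d j) = 0) (h0 : v 0 = w 0) : v = w := by
  have sign : ∀ {v : Fin (k + 2) → ℝ} {c : Fin (k + 1) → ℝ}, (∀ i, v i = 0 ∨ v i = 1) →
      (∀ j, 0 < c j) → ∑ j, c j < 1 → ∀ i, (v i = 0 ∧ v i - ∑ j, P i j * c j ≤ 0) ∨
        (v i = 1 ∧ 0 < v i - ∑ j, P i j * c j) := by
    intro v c hv hc hcs i
    have := hP01.sum_mul_mem hc hcs i
    rcases hv i with h | h
    · exact Or.inl ⟨h, by linarith⟩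
    · exact Or.inr ⟨h, by linarith⟩
  have first : ∀ {v : Fin (k + 2) → ℝ} {c : Fin (k + 1) → ℝ}, (∀ i, v i = 0 ∨ v i = 1) →
      (∀ j, 0 < c j) → ∑ j, c j < 1 → (∀ i, ∑ l, P l i * (v l - ∑ j, P l j * c j) = 0) →
      v 0 - ∑ j, P 0 j * c j ≠ 0 := by
    intro v c hv hc hcs hvc h
    have h1 := hP.eq_zero_of_vecMul_eq_zero (z := fun l => v l - ∑ j, P l j * c j) hvc h 1
    have h2 : P 1 0 = 1 := hP.2 0 (by simp)
    have h3 := hP01.sum_mul_pos hc h2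
    have h4 := (hP01.sum_mul_mem hc hcs 1).2
    rcases hv 1 with h | h <;> simp only [h] at h1 <;> linarith
  have sv := sign hv hc hcs
  have sw := sign hw hd hds
  have fv := first hv hc hcs hvc
  have fw := first hw hd hds hwd
  set a := fun l => v l - ∑ j, P l j * c j with ha
  set b := fun l => w l - ∑ j, P l j * d j with hb
  have prop : ∀ i, b 0 * a i - a 0 * b i = 0 := by
    refine hP.eq_zero_of_vecMul_eq_zero (fun i => ?_) (by ring)
    have : ∑ l, P l i * (b 0 * a l - a 0 * b l) =
        b 0 * ∑ l, P l i * a l - a 0 * ∑ l, P l i * b l := by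
      rw [Finset.mul_sum, Finset.mul_sum, ← Finset.sum_sub_distrib]
      exact Finset.sum_congr rfl fun l _ => by ring
    rw [this, hvc i, hwd i]
    ring
  have sv' : ∀ i, (v i = 0 ∧ a i ≤ 0) ∨ (v i = 1 ∧ 0 < a i) := sv
  have sw' : ∀ i, (w i = 0 ∧ b i ≤ 0) ∨ (w i = 1 ∧ 0 < b i) := sw
  have fv' : a 0 ≠ 0 := fv
  have fw' : b 0 ≠ 0 := fw
  have hab : 0 < a 0 * b 0 := by
    rcases sv' 0 with ⟨h1, h2⟩ | ⟨h1, h2⟩ <;> rcases sw' 0 with ⟨h3, h4⟩ | ⟨h3, h4⟩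
    · exact mul_pos_of_neg_of_neg (lt_of_le_of_ne h2 fv') (lt_of_le_of_ne h4 fw')
    · exact absurd (h1.symm.trans (h0.trans h3)) (by norm_num)
    · exact absurd (h3.symm.trans (h0.symm.trans h1)) (by norm_num)
    · exact mul_pos h2 h4
  have hiff : ∀ i, 0 < a i ↔ 0 < b i := by
    intro i
    have h1 : a 0 * b 0 * a i = a 0 ^ 2 * b i := by linear_combination a 0 * prop i
    have h2 : 0 < a 0 ^ 2 := by positivity
    rw [← mul_pos_iff_of_pos_left hab, h1, mul_pos_iff_of_pos_left h2]
  ext i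
  rcases sv' i with ⟨h1, h2⟩ | ⟨h1, h2⟩ <;> rcases sw' i with ⟨h3, h4⟩ | ⟨h3, h4⟩
  · rw [h1, h3]
  · exact absurd ((hiff i).2 h4) h2.not_gt
  · exact absurd ((hiff i).1 h2) h4.not_gt
  · rw [h1, h3]

/-- An acute unreduced upper Hessenberg 0/1-matrix is determined by its first row. -/
lemma eq_of_first_row_eq {k : ℕ} {H K : Matrix (Fin (k + 1)) (Fin k) ℝ}
    (hH01 : ZeroOneEntries H) (hH : IsUnreducedUpperHessenberg H) (hHA : RepresentsAcute H)
    (hK01 : ZeroOneEntries K) (hK : IsUnreducedUpperHessenberg K) (hKA : RepresentsAcute K)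
    (h0 : ∀ j, H 0 j = K 0 j) : H = K := by
  induction k with
  | zero => exact Matrix.ext fun _ j => j.elim0
  | succ k ih =>
    have hPQ := ih (fun i j => hH01 i.castSucc j.castSucc) hH.submatrix_castSucc
      (hHA.submatrix_castSucc hH) (fun i j => hK01 i.castSucc j.castSucc) hK.submatrix_castSucc
      (hKA.submatrix_castSucc hK) (fun j => h0 j.castSucc)
    have hlast : (fun i : Fin (k + 1) => H i.castSucc (Fin.last k)) =
        fun i => K i.castSucc (Fin.last k) := by
      cases k with
      | zero =>
        funext i
        obtain rfl : i = 0 := Fin.ext (by simp)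
        exact h0 _
      | succ k =>
        obtain ⟨c, hc, hcs, hvc⟩ := hHA.exists_projection hH
        obtain ⟨d, hd, hds, hwd⟩ := hKA.exists_projection hK
        have hHK : ∀ i j, K (Fin.castSucc i) (Fin.castSucc j) = H i.castSucc j.castSucc :=
          fun i j => (congrFun (congrFun hPQ i) j).symm
        simp only [hHK] at hwd
        exact eq_of_projection hH.submatrix_castSucc (fun i j => hH01 i.castSucc j.castSucc)
          (fun i => hH01 _ _) (fun i => hK01 _ _) hc hcs hd hds hvc hwd (h0 _)
    ext i j
    induction i using Fin.lastCases with
    | last =>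
      induction j using Fin.lastCases with
      | last => exact (hH.2 (Fin.last k) (by simp)).trans (hK.2 (Fin.last k) (by simp)).symm
      | cast j =>
        have hj : ((j.castSucc : Fin (k + 1)) : ℕ) + 1 < (Fin.last (k + 1) : Fin (k + 2)) := by
          simp
        rw [hH.1 _ _ hj, hK.1 _ _ hj]
    | cast i =>
      induction j using Fin.lastCases with
      | last => exact congrFun hlast i
      | cast j => exact congrFun (congrFun hPQ i) j

/-- The top left entry of an acute unreduced upper Hessenberg 0/1-matrix with at least two columns
is `1`. -/
lemma RepresentsAcute.apply_zero_zero {k : ℕ} {H : Matrix (Fin (k + 3)) (Fin (k + 2)) ℝ}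
    (hH01 : ZeroOneEntries H) (hH : IsUnreducedUpperHessenberg H) (hA : RepresentsAcute H) :
    H 0 0 = 1 := by
  refine (hH01 0 0).resolve_left fun h00 => ?_
  obtain ⟨c, hc, hcs, hvc⟩ := hA.exists_projection hH
  have hP01 : ZeroOneEntries (H.submatrix Fin.castSucc Fin.castSucc) :=
    fun i j => hH01 i.castSucc j.castSucc
  have h10 : H (Fin.castSucc 1) (Fin.castSucc 0) = 1 := hH.2 0 (by simp)
  have h1 := hvc 0
  rw [Finset.sum_eq_single 1] at h1
  · rw [h10, one_mul] at h1
    have h2 : 0 < ∑ j : Fin (k + 1), H (Fin.castSucc 1) j.castSucc * c j :=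
      hP01.sum_mul_pos hc (i := 1) (j := 0) h10
    have h3 : ∑ j : Fin (k + 1), H (Fin.castSucc 1) j.castSucc * c j < 1 :=
      (hP01.sum_mul_mem hc hcs 1).2
    rcases hH01 (Fin.castSucc 1) (Fin.last (k + 1)) with h | h <;> rw [h] at h1 <;> linarith
  · intro l _ hl
    have : H l.castSucc (Fin.castSucc 0) = 0 := by
      induction l using Fin.cases with
      | zero => exact h00
      | succ l =>
        refine hH.1 _ _ ?_
        have hl0 : l ≠ 0 := fun h => hl (by rw [h]; rfl)
        exact Nat.succ_lt_succ (Fin.pos_iff_ne_zero.2 hl0)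
    rw [this, zero_mul]
  · simp

/-- For `n ≥ 3`, there are at most `2 ^ (n - 2)` unreduced upper Hessenberg
`n × (n-1)` 0/1-matrices representing an acute 0/1-simplex. -/
theorem count_uuh_acute_le (n : ℕ) (hn : 3 ≤ n) :
    Set.ncard {H : Matrix (Fin n) (Fin (n - 1)) ℝ |
        ZeroOneEntries H ∧ IsUnreducedUpperHessenberg H ∧ RepresentsAcute H} ≤
      2 ^ (n - 2) := by
  classical
  obtain ⟨m, rfl⟩ := Nat.exists_eq_add_of_le' hn
  change Set.ncard {H : Matrix (Fin (m + 3)) (Fin (m + 2)) ℝ |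
    ZeroOneEntries H ∧ IsUnreducedUpperHessenberg H ∧ RepresentsAcute H} ≤ 2 ^ (m + 1)
  let f : Matrix (Fin (m + 3)) (Fin (m + 2)) ℝ → Fin (m + 1) → Bool :=
    fun H j => decide (H 0 j.succ = 1)
  have hcard : (Set.univ : Set (Fin (m + 1) → Bool)).ncard = 2 ^ (m + 1) := by
    rw [Set.ncard_univ, Nat.card_eq_fintype_card, Fintype.card_fun, Fintype.card_bool,
      Fintype.card_fin]
  rw [← hcard]
  refine Set.ncard_le_ncard_of_injOn f (fun _ _ => Set.mem_univ _) ?_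
  rintro H ⟨hH01, hH, hHA⟩ K ⟨hK01, hK, hKA⟩ hf
  refine eq_of_first_row_eq hH01 hH hHA hK01 hK hKA fun j => ?_
  induction j using Fin.cases with
  | zero => rw [hHA.apply_zero_zero hH01 hH, hKA.apply_zero_zero hK01 hK]
  | succ j =>
    have h : H 0 j.succ = 1 ↔ K 0 j.succ = 1 := by simpa [f] using congrFun hf j
    rcases hH01 0 j.succ with h1 | h1 <;> rcases hK01 0 j.succ with h2 | h2 <;>
      simp [h1, h2] at h ⊢
end

section
/- Let H be an n×(n−1) matrix with entries in {0,1}, and let g, h ∈ {0,1}^n be vectors with g + h equal to the all-ones vector. Consider the (n+1)×(n+1) matrices M₁ = [[H, g, g],[0ᵀ, 1, 0]], M₂ = [[H, g, g],[0ᵀ, 1, 1]], and M₃ = [[H, g, h],[0ᵀ, 1, 0]] (each obtained by appending the indicated two columns, extended by a last row that is zero on the first n−1 entries and has the indicated last two entries). Then M₂ is singular, and neither M₁ nor M₃ represents an acute 0/1-simplex; consequently, among the matrices [[H, g, v],[0ᵀ, 1, a]] with v ∈ {g, h} and a ∈ {0,1}, only the choice v = h, a = 1 can represent an acute 0/1-simplex.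 -/
open Matrix BigOperators

/-- The `(n+2) × (n+2)` matrix `[[H, g, v], [0ᵀ, 1, a]]`: its first `n` columns are
the columns of the `(n+1) × n` matrix `H` extended by a `0` in the last row, its
second-to-last column is `g` extended by `1`, and its last column is `v` extended
by `a`. -/
def extMat (n : ℕ) (H : Matrix (Fin (n + 1)) (Fin n) ℝ) (g v : Fin (n + 1) → ℝ) (a : ℝ) :
    Matrix (Fin (n + 2)) (Fin (n + 2)) ℝ :=
  Matrix.of fun i j =>
    if hi : (i : ℕ) < n + 1 then
      if hj : (j : ℕ) < n then H ⟨i, hi⟩ ⟨j, hj⟩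
      else if (j : ℕ) = n then g ⟨i, hi⟩
      else v ⟨i, hi⟩
    else
      if (j : ℕ) < n then 0 else if (j : ℕ) = n then 1 else a

theorem extMat_mulVec_castSucc (n : ℕ) (H : Matrix (Fin (n + 1)) (Fin n) ℝ)
    (g v : Fin (n + 1) → ℝ) (a : ℝ) (x : Fin (n + 2) → ℝ) (i : Fin (n + 1)) :
    (extMat n H g v a *ᵥ x) i.castSucc =
      ∑ j, H i j * x j.castSucc.castSucc + g i * x (Fin.last n).castSucc
        + v i * x (Fin.last (n + 1)) := by
  simp [Matrix.mulVec, dotProduct, Fin.sum_univ_castSucc, extMat, Nat.le_of_lt_succ i.isLt]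

theorem extMat_last (n : ℕ) (H : Matrix (Fin (n + 1)) (Fin n) ℝ) (g v : Fin (n + 1) → ℝ)
    (j : Fin (n + 2)) :
    extMat n H g v 0 (Fin.last (n + 1)) j =
      (Pi.single (Fin.last n).castSucc 1 : Fin (n + 2) → ℝ) j := by
  refine Fin.lastCases ?_ (fun j => Fin.lastCases ?_ (fun j => ?_) j) j
  · simp [extMat, Fin.ext_iff]
  · simp [extMat]
  · simp [extMat, Fin.ext_iff, j.isLt.ne]

/-- If row `r` of a square matrix representing an acute simplex is the `s`-th unit vector,
the solution of `P x = e_r` is column `s` of the inverse Gramian, so it inherits its signs. -/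
theorem RepresentsAcute.exists_mulVec_eq_single {m : ℕ} {P : Matrix (Fin m) (Fin m) ℝ}
    (hP : RepresentsAcute P) {r s : Fin m}
    (hrow : ∀ j, P r j = (Pi.single s 1 : Fin m → ℝ) j) :
    IsUnit P ∧ ∃ x : Fin m → ℝ, P *ᵥ x = Pi.single r 1 ∧ (∀ i, i ≠ s → x i < 0) ∧
      0 < ∑ i, x i := by
  obtain ⟨hdet, hneg, hsum⟩ := hP
  have hPdet : IsUnit P.det := by
    rw [Matrix.det_mul] at hdet
    exact isUnit_of_mul_isUnit_right hdet
  have hsymm : ∀ i j, (Pᵀ * P)⁻¹ i j = (Pᵀ * P)⁻¹ j i := fun i j => by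
    have h : ((Pᵀ * P)⁻¹)ᵀ = (Pᵀ * P)⁻¹ := by
      rw [Matrix.transpose_nonsing_inv, Matrix.transpose_mul, Matrix.transpose_transpose]
    exact congrFun (congrFun h j) i
  refine ⟨(Matrix.isUnit_iff_isUnit_det P).2 hPdet, (Pᵀ * P)⁻¹ *ᵥ Pi.single s 1, ?_, ?_, ?_⟩
  · have hinj : Function.Injective Pᵀ.mulVec :=
      Matrix.mulVec_injective_of_isUnit
        ((Matrix.isUnit_iff_isUnit_det _).2 (by rwa [Matrix.det_transpose]))
    apply hinj
    rw [Matrix.mulVec_mulVec, Matrix.mulVec_mulVec, Matrix.mul_nonsing_inv _ hdet,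
      Matrix.one_mulVec, Matrix.mulVec_single_one]
    funext j
    exact (hrow j).symm
  · intro i hi
    simpa using hneg i s hi
  · simpa [hsymm _ s] using hsum s

theorem not_representsAcute_extMat_self (n : ℕ) (H : Matrix (Fin (n + 1)) (Fin n) ℝ)
    (g : Fin (n + 1) → ℝ) : ¬ RepresentsAcute (extMat n H g g 0) := by
  intro hP
  obtain ⟨hunit, x, hx, -, hsum⟩ := hP.exists_mulVec_eq_single (extMat_last n H g g)
  have hc : extMat n H g g 0 *ᵥ
      (Pi.single (Fin.last n).castSucc 1 - Pi.single (Fin.last (n + 1)) 1) =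
      Pi.single (Fin.last (n + 1)) 1 := by
    rw [Matrix.mulVec_sub, Matrix.mulVec_single_one, Matrix.mulVec_single_one]
    funext i
    refine Fin.lastCases ?_ (fun i => ?_) i
    · simp [extMat]
    · simp [extMat, Nat.le_of_lt_succ i.isLt]
  have hxc := Matrix.mulVec_injective_of_isUnit hunit (hx.trans hc.symm)
  simp [hxc] at hsum

theorem not_representsAcute_extMat_compl (n : ℕ) (H : Matrix (Fin (n + 1)) (Fin n) ℝ)
    (h01 : ∀ i j, H i j = 0 ∨ H i j = 1) (g h : Fin (n + 1) → ℝ)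
    (hg : ∀ i, g i = 0 ∨ g i = 1) (hgh : ∀ i, g i + h i = 1) :
    ¬ RepresentsAcute (extMat n H g h 0) := by
  intro hP
  obtain ⟨-, x, hx, hneg, hsum⟩ := hP.exists_mulVec_eq_single (extMat_last n H g h)
  have hlast : x (Fin.last n).castSucc = 1 := by
    have := congrFun hx (Fin.last (n + 1))
    simpa only [Matrix.mulVec, dotProduct, extMat_last, Pi.single_apply, ite_mul, one_mul,
      zero_mul, Finset.sum_ite_eq', Finset.mem_univ, if_true] using this
  have hrow := congrFun hx (Fin.castSucc 0)
  rw [extMat_mulVec_castSucc, hlast, Pi.single_eq_of_ne (Fin.castSucc_lt_last _).ne] at hrow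
  have ht : x (Fin.last (n + 1)) < 0 := hneg _ (Fin.castSucc_lt_last _).ne'
  have hy : ∀ j : Fin n, x j.castSucc.castSucc < 0 := fun j =>
    hneg _ (by simp [Fin.ext_iff, j.isLt.ne])
  rw [Fin.sum_univ_castSucc, Fin.sum_univ_castSucc, hlast] at hsum
  have hle : ∑ j, H 0 j * x j.castSucc.castSucc ≤ 0 :=
    Finset.sum_nonpos fun j _ => by
      rcases h01 0 j with hj | hj <;> simp [hj, (hy j).le]
  have hge : ∑ j : Fin n, x j.castSucc.castSucc ≤ ∑ j, H 0 j * x j.castSucc.castSucc :=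
    Finset.sum_le_sum fun j _ => by
      rcases h01 0 j with hj | hj <;> simp [hj, (hy j).le]
  have hgh0 := hgh 0
  rcases hg 0 with hg0 | hg0
  · have hh0 : h 0 = 1 := by linarith
    rw [hg0, hh0] at hrow
    linarith
  · have hh0 : h 0 = 0 := by linarith
    rw [hg0, hh0] at hrow
    linarith

theorem det_extMat_self_one (n : ℕ) (H : Matrix (Fin (n + 1)) (Fin n) ℝ)
    (g : Fin (n + 1) → ℝ) : (extMat n H g g 1).det = 0 := by
  refine Matrix.det_zero_of_column_eq (Fin.castSucc_lt_last (Fin.last n)).ne fun i => ?_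
  refine Fin.lastCases ?_ (fun i => ?_) i <;> simp [extMat]

/-- For an `(n+1) × n` 0/1-matrix `H` and complementary 0/1-vectors `g + h = e`:
`M₂ = [[H,g,g],[0ᵀ,1,1]]` is singular, neither `M₁ = [[H,g,g],[0ᵀ,1,0]]` nor
`M₃ = [[H,g,h],[0ᵀ,1,0]]` represents an acute 0/1-simplex; consequently among the
matrices `[[H,g,v],[0ᵀ,1,a]]` with `v ∈ {g,h}` and `a ∈ {0,1}`, only `v = h`, `a = 1`
can represent an acute 0/1-simplex. -/
theorem only_one_acute_extension (n : ℕ) (H : Matrix (Fin (n + 1)) (Fin n) ℝ)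
    (h01 : ∀ i j, H i j = 0 ∨ H i j = 1)
    (g h : Fin (n + 1) → ℝ)
    (hg : ∀ i, g i = 0 ∨ g i = 1) (hh : ∀ i, h i = 0 ∨ h i = 1)
    (hgh : ∀ i, g i + h i = 1) :
    (extMat n H g g 1).det = 0 ∧
    ¬ RepresentsAcute (extMat n H g g 0) ∧
    ¬ RepresentsAcute (extMat n H g h 0) ∧
    (∀ (v : Fin (n + 1) → ℝ) (a : ℝ), (v = g ∨ v = h) → (a = 0 ∨ a = 1) →
      RepresentsAcute (extMat n H g v a) → v = h ∧ a = 1) := by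
  refine ⟨det_extMat_self_one n H g, not_representsAcute_extMat_self n H g,
    not_representsAcute_extMat_compl n H h01 g h hg hgh, ?_⟩
  rintro v a (rfl | rfl) (rfl | rfl) hP
  · exact absurd hP (not_representsAcute_extMat_self n H v)
  · have hdet := hP.1
    rw [Matrix.det_mul, det_extMat_self_one, mul_zero] at hdet
    exact absurd hdet not_isUnit_zero
  · exact absurd hP (not_representsAcute_extMat_compl n H h01 g v hg hgh)
  · exact ⟨rfl, rfl⟩
end

section
/- For every natural number n, the number of triples (a, b, c) of natural numbers satisfying 1 ≤ a, a ≤ b, b ≤ c, and a + b + c ≤ n equals ⌊(2n³ + 3n² − 6n + 9)/72⌋. (These triples are in bijection with the 0/1-equivalence classes of acute 0/1-triangles in the unit n-cube.) -/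
/-- Ordered pairs of positive integers with sum at most `m`. -/
def orderedPairs (m : ℕ) : Set (ℕ × ℕ) :=
  {p | 1 ≤ p.1 ∧ p.1 ≤ p.2 ∧ p.1 + p.2 ≤ m}

/-- Ordered triples of positive integers with sum at most `n`. -/
def orderedTriples (n : ℕ) : Set (ℕ × ℕ × ℕ) :=
  {t | 1 ≤ t.1 ∧ t.1 ≤ t.2.1 ∧ t.2.1 ≤ t.2.2 ∧ t.1 + t.2.1 + t.2.2 ≤ n}

theorem finite_orderedPairs (m : ℕ) : (orderedPairs m).Finite := by
  refine (Set.finite_Iic (m, m)).subset fun p hp => ?_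
  simp only [orderedPairs, Set.mem_ofPred_eq] at hp
  simp only [Set.mem_Iic, Prod.le_def]
  lia

theorem finite_orderedTriples (n : ℕ) : (orderedTriples n).Finite := by
  refine (Set.finite_Iic (n, n, n)).subset fun t ht => ?_
  simp only [orderedTriples, Set.mem_ofPred_eq] at ht
  simp only [Set.mem_Iic, Prod.le_def]
  lia

/-- Split according to whether the smaller entry is `1`. -/
theorem orderedPairs_add_two (m : ℕ) :
    orderedPairs (m + 2) =
      (fun p : ℕ × ℕ => (p.1 + 1, p.2 + 1)) '' orderedPairs m ∪
        (fun c : ℕ => (1, c)) '' Set.Icc 1 (m + 1) := by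
  ext ⟨b, c⟩
  simp only [orderedPairs, Set.mem_union, Set.mem_image, Set.mem_ofPred_eq, Set.mem_Icc,
    Prod.exists, Prod.mk.injEq]
  constructor
  · intro h
    obtain hb | hb := Nat.lt_or_ge 1 b
    · exact .inl ⟨b - 1, c - 1, by lia⟩
    · exact .inr ⟨c, by lia⟩
  · rintro (⟨x, y, h⟩ | ⟨y, h⟩) <;> lia

/-- Split according to whether the smallest entry is `1`. -/
theorem orderedTriples_add_three (n : ℕ) :
    orderedTriples (n + 3) =
      (fun t : ℕ × ℕ × ℕ => (t.1 + 1, t.2.1 + 1, t.2.2 + 1)) '' orderedTriples n ∪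
        (fun p : ℕ × ℕ => (1, p)) '' orderedPairs (n + 2) := by
  ext ⟨a, b, c⟩
  simp only [orderedTriples, orderedPairs, Set.mem_union, Set.mem_image, Set.mem_ofPred_eq,
    Prod.exists, Prod.mk.injEq]
  constructor
  · intro h
    obtain ha | ha := Nat.lt_or_ge 1 a
    · exact .inl ⟨a - 1, b - 1, c - 1, by lia⟩
    · exact .inr ⟨b, c, by lia⟩
  · rintro (⟨x, y, z, h⟩ | ⟨y, z, h⟩) <;> lia

theorem ncard_orderedPairs_add_two (m : ℕ) :
    (orderedPairs (m + 2)).ncard = (orderedPairs m).ncard + (m + 1) := by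
  rw [orderedPairs_add_two, Set.ncard_union_eq _ ((finite_orderedPairs m).image _)
    ((Set.finite_Icc _ _).image _), Set.ncard_image_of_injective, Set.ncard_image_of_injective]
  · simp [Set.ncard_eq_toFinset_card']
  · exact Prod.mk_right_injective 1
  · rintro ⟨a, b⟩ ⟨c, d⟩ h
    simpa using h
  · rw [Set.disjoint_left]
    rintro _ ⟨p, hp, rfl⟩ ⟨c, -, h⟩
    simp only [orderedPairs, Set.mem_ofPred_eq, Prod.mk.injEq] at hp h
    lia

theorem ncard_orderedTriples_add_three (n : ℕ) :
    (orderedTriples (n + 3)).ncard =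
      (orderedTriples n).ncard + (orderedPairs (n + 2)).ncard := by
  rw [orderedTriples_add_three, Set.ncard_union_eq _ ((finite_orderedTriples n).image _)
    ((finite_orderedPairs _).image _), Set.ncard_image_of_injective,
    Set.ncard_image_of_injective]
  · exact Prod.mk_right_injective 1
  · rintro ⟨a, b, c⟩ ⟨d, e, f⟩ h
    simpa using h
  · rw [Set.disjoint_left]
    rintro _ ⟨t, ht, rfl⟩ ⟨p, -, h⟩
    simp only [orderedTriples, Set.mem_ofPred_eq, Prod.mk.injEq] at ht h
    lia

theorem ncard_orderedPairs_of_lt_two {m : ℕ} (hm : m < 2) : (orderedPairs m).ncard = 0 := by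
  rw [Set.ncard_eq_zero (finite_orderedPairs m), Set.eq_empty_iff_forall_notMem]
  intro p hp
  simp only [orderedPairs, Set.mem_ofPred_eq] at hp
  lia

theorem ncard_orderedTriples_of_lt_three {n : ℕ} (hn : n < 3) :
    (orderedTriples n).ncard = 0 := by
  rw [Set.ncard_eq_zero (finite_orderedTriples n), Set.eq_empty_iff_forall_notMem]
  intro t ht
  simp only [orderedTriples, Set.mem_ofPred_eq] at ht
  lia

theorem two_mul_ncard_orderedPairs_add_succ (m : ℕ) :
    2 * ((orderedPairs m).ncard + (orderedPairs (m + 1)).ncard) = m * (m + 1) := by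
  induction m with
  | zero => simp [ncard_orderedPairs_of_lt_two]
  | succ m ih =>
    rw [ncard_orderedPairs_add_two]
    linarith

theorem two_mul_ncard_orderedTriples_add_six (n : ℕ) :
    2 * (orderedTriples (n + 6)).ncard =
      2 * (orderedTriples n).ncard + (n ^ 2 + 7 * n + 14) := by
  have h₁ := ncard_orderedTriples_add_three n
  have h₂ := ncard_orderedTriples_add_three (n + 3)
  have h₃ := ncard_orderedPairs_add_two (n + 3)
  have h₄ := two_mul_ncard_orderedPairs_add_succ (n + 2)
  simp only [add_assoc, Nat.reduceAdd] at h₁ h₂ h₃ h₄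
  linarith

theorem ncard_orderedTriples (n : ℕ) :
    (orderedTriples n).ncard = (2 * n ^ 3 + 3 * n ^ 2 + 9 - 6 * n) / 72 := by
  induction n using Nat.strong_induction_on with
  | _ n ih =>
    obtain hn | hn := Nat.lt_or_ge n 6
    · have p₀ := ncard_orderedPairs_of_lt_two (m := 0) (by simp)
      have p₁ := ncard_orderedPairs_of_lt_two (m := 1) (by simp)
      have p₂ := ncard_orderedPairs_add_two 0
      have p₃ := ncard_orderedPairs_add_two 1
      have p₄ := ncard_orderedPairs_add_two 2
      have t₀ := ncard_orderedTriples_of_lt_three (n := 0) (by simp)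
      have t₁ := ncard_orderedTriples_of_lt_three (n := 1) (by simp)
      have t₂ := ncard_orderedTriples_of_lt_three (n := 2) (by simp)
      have t₃ := ncard_orderedTriples_add_three 0
      have t₄ := ncard_orderedTriples_add_three 1
      have t₅ := ncard_orderedTriples_add_three 2
      simp only [Nat.reduceAdd] at p₂ p₃ p₄ t₃ t₄ t₅
      interval_cases n <;> lia
    · obtain ⟨m, rfl⟩ := Nat.exists_eq_add_of_le' hn
      have hrec := two_mul_ncard_orderedTriples_add_six m
      have hm := ih m (by lia)
      have hpoly : 2 * (m + 6) ^ 3 + 3 * (m + 6) ^ 2 + 9 =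
          2 * m ^ 3 + 3 * m ^ 2 + 9 + 36 * (m ^ 2 + 7 * m + 14) + 36 := by ring
      have hle : 6 * m ≤ 2 * m ^ 3 + 3 * m ^ 2 + 9 := by
        zify
        nlinarith [sq_nonneg ((m : ℤ) - 1), pow_nonneg (Int.natCast_nonneg m) 3]
      lia

/-- The number of triples `(a, b, c)` of natural numbers with `1 ≤ a ≤ b ≤ c` and
`a + b + c ≤ n` (which parametrize the 0/1-equivalence classes of acute 0/1-triangles
in the unit `n`-cube) equals `⌊(2n³ + 3n² - 6n + 9)/72⌋`. -/
theorem card_acute_triangles (n : ℕ) :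
    Nat.card {t : ℕ × ℕ × ℕ //
        1 ≤ t.1 ∧ t.1 ≤ t.2.1 ∧ t.2.1 ≤ t.2.2 ∧ t.1 + t.2.1 + t.2.2 ≤ n} =
      (2 * n ^ 3 + 3 * n ^ 2 + 9 - 6 * n) / 72 :=
  ncard_orderedTriples n
end

section
/- Let k ≥ 1, let G be a real symmetric positive definite k×k matrix such that G^{-1} has all off-diagonal entries negative and all row sums positive, and let g ∈ ℝᵏ be such that h = G^{-1}g satisfies h_i > 0 for all i and ∑_i h_i < 1. Then there exists a real number ℓ such that for every γ ≥ ℓ, the (k+1)×(k+1) block matrix Ĝ(γ) = [[G, g],[gᵀ, γ]] is invertible and Ĝ(γ)^{-1} has all off-diagonal entries negative and all row sums positive. -/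
open Matrix BigOperators

/-- The bordered Gramian `Ĝ(γ) = [[G, g], [gᵀ, γ]]`. -/
def hatG {k : ℕ} (G : Matrix (Fin k) (Fin k) ℝ) (g : Fin k → ℝ) (γ : ℝ) :
    Matrix (Fin (k + 1)) (Fin (k + 1)) ℝ :=
  Matrix.of fun i j =>
    if hi : (i : ℕ) < k then
      if hj : (j : ℕ) < k then G ⟨i, hi⟩ ⟨j, hj⟩ else g ⟨i, hi⟩
    else if hj : (j : ℕ) < k then g ⟨j, hj⟩ else γ

open Filter Topology in
/-- For large `γ`, adding `(γ - b)⁻¹ * c` to a positive number keeps it positive. -/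
lemma eventually_pos_add_inv_mul (a b c : ℝ) (ha : 0 < a) :
    ∀ᶠ γ : ℝ in atTop, 0 < a + (γ - b)⁻¹ * c := by
  have ht : Tendsto (fun γ : ℝ => (γ - b)⁻¹) atTop (𝓝 0) :=
    tendsto_inv_atTop_zero.comp (tendsto_atTop_add_const_right _ (-b) tendsto_id)
  have h := (ht.mul_const c).const_add a
  rw [zero_mul, add_zero] at h
  exact h.eventually (lt_mem_nhds ha)

/-- The inverse of a bordered matrix, in terms of the inverse `B` of the leading block, the
vector `h = B g` and the reciprocal `t` of the Schur complement. -/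
def borderedInverse {k : ℕ} (B : Matrix (Fin k) (Fin k) ℝ) (h : Fin k → ℝ) (t : ℝ) :
    Matrix (Fin (k + 1)) (Fin (k + 1)) ℝ :=
  Matrix.of fun i j =>
    Fin.lastCases (motive := fun _ => ℝ)
      (Fin.lastCases (motive := fun _ => ℝ) t (fun j => -(t * h j)) j)
      (fun i => Fin.lastCases (motive := fun _ => ℝ) (-(t * h i))
        (fun j => B i j + t * h i * h j) j) i

lemma hatG_mul_borderedInverse {k : ℕ} {G B : Matrix (Fin k) (Fin k) ℝ} {g h : Fin k → ℝ}
    {γ t : ℝ} (hGB : G * B = 1) (hGh : G *ᵥ h = g) (hgB : g ᵥ* B = h)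
    (ht : (γ - g ⬝ᵥ h) * t = 1) :
    hatG G g γ * borderedInverse B h t = 1 := by
  have hGh' (i : Fin k) : ∑ l, G i l * h l = g i := congrFun hGh i
  have hgB' (j : Fin k) : ∑ l, g l * B l j = h j := congrFun hgB j
  have hGB' (i j : Fin k) : ∑ l, G i l * B l j = (1 : Matrix (Fin k) (Fin k) ℝ) i j := by
    rw [← hGB, Matrix.mul_apply]
  simp only [dotProduct] at ht
  ext i j
  rw [Matrix.mul_apply, Fin.sum_univ_castSucc]
  refine Fin.lastCases ?_ (fun i => ?_) i <;> refine Fin.lastCases ?_ (fun j => ?_) j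
  · have e : ∑ l, g l * -(t * h l) = -t * ∑ l, g l * h l := by
      rw [Finset.mul_sum]; exact Finset.sum_congr rfl fun _ _ => by ring
    simp only [hatG, borderedInverse, Matrix.of_apply, Fin.lastCases_last,
      Fin.lastCases_castSucc, Fin.val_castSucc, Fin.val_last, Fin.is_lt, lt_irrefl,
      dite_true, dite_false, Fin.eta, Matrix.one_apply_eq, e]
    linear_combination ht
  · have e : ∑ l, g l * (B l j + t * h l * h j)
        = ∑ l, g l * B l j + t * h j * ∑ l, g l * h l := by
      rw [Finset.mul_sum, ← Finset.sum_add_distrib]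
      exact Finset.sum_congr rfl fun _ _ => by ring
    simp only [hatG, borderedInverse, Matrix.of_apply, Fin.lastCases_last,
      Fin.lastCases_castSucc, Fin.val_castSucc, Fin.val_last, Fin.is_lt, lt_irrefl,
      dite_true, dite_false, Fin.eta, e, hgB', Matrix.one_apply_ne (Fin.castSucc_ne_last j).symm]
    linear_combination -h j * ht
  · have e : ∑ l, G i l * -(t * h l) = -t * ∑ l, G i l * h l := by
      rw [Finset.mul_sum]; exact Finset.sum_congr rfl fun _ _ => by ring
    simp only [hatG, borderedInverse, Matrix.of_apply, Fin.lastCases_last,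
      Fin.lastCases_castSucc, Fin.val_castSucc, Fin.val_last, Fin.is_lt, lt_irrefl,
      dite_true, dite_false, Fin.eta, e, hGh', Matrix.one_apply_ne (Fin.castSucc_ne_last i)]
    ring
  · have e : ∑ l, G i l * (B l j + t * h l * h j)
        = ∑ l, G i l * B l j + t * h j * ∑ l, G i l * h l := by
      rw [Finset.mul_sum, ← Finset.sum_add_distrib]
      exact Finset.sum_congr rfl fun _ _ => by ring
    simp only [hatG, borderedInverse, Matrix.of_apply, Fin.lastCases_last,
      Fin.lastCases_castSucc, Fin.val_castSucc, Fin.val_last, Fin.is_lt, lt_irrefl,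
      dite_true, dite_false, Fin.eta, e, hGB', hGh', Matrix.one_apply, Fin.castSucc_inj]
    ring

/-- Let `G` be a symmetric positive definite `k × k` matrix (`k ≥ 1`) whose inverse
has negative off-diagonal entries and positive row sums, and let `g` be such that
`h = G⁻¹ g` has positive entries summing to less than `1`. Then there is a threshold
`ℓ` such that for every `γ ≥ ℓ`, the bordered matrix `Ĝ(γ) = [[G, g], [gᵀ, γ]]` is
invertible and its inverse has negative off-diagonal entries and positive row sums. -/
theorem bordered_gramian_eventually_acute (k : ℕ) (hk : 1 ≤ k)
    (G : Matrix (Fin k) (Fin k) ℝ) (hsym : G.IsSymm) (hpd : G.PosDef)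
    (hoff : ∀ i j, i ≠ j → G⁻¹ i j < 0)
    (hrow : ∀ i, 0 < ∑ j, G⁻¹ i j)
    (g : Fin k → ℝ)
    (hpos : ∀ i, 0 < (G⁻¹ *ᵥ g) i)
    (hsum : ∑ i, (G⁻¹ *ᵥ g) i < 1) :
    ∃ l : ℝ, ∀ γ : ℝ, l ≤ γ →
      IsUnit (hatG G g γ).det ∧
      (∀ i j, i ≠ j → (hatG G g γ)⁻¹ i j < 0) ∧
      (∀ i, 0 < ∑ j, (hatG G g γ)⁻¹ i j) := by
  have hdet : IsUnit G.det := hpd.det_pos.ne'.isUnit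
  have hGB : G * G⁻¹ = 1 := Matrix.mul_nonsing_inv G hdet
  set h := G⁻¹ *ᵥ g with hh
  have hGh : G *ᵥ h = g := by rw [hh, Matrix.mulVec_mulVec, hGB, Matrix.one_mulVec]
  have hgB : g ᵥ* G⁻¹ = h := by
    rw [hh, ← Matrix.vecMul_transpose, Matrix.transpose_nonsing_inv, hsym.eq]
  have hoffdiag : ∀ᶠ γ : ℝ in Filter.atTop, ∀ i j, i ≠ j →
      0 < -G⁻¹ i j + (γ - g ⬝ᵥ h)⁻¹ * -(h i * h j) := by
    simp only [Filter.eventually_all]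
    exact fun i j hij => eventually_pos_add_inv_mul _ _ _ (neg_pos.2 (hoff i j hij))
  have hrows : ∀ᶠ γ : ℝ in Filter.atTop, ∀ i,
      0 < ∑ j, G⁻¹ i j + (γ - g ⬝ᵥ h)⁻¹ * (h i * (∑ j, h j - 1)) :=
    Filter.eventually_all.2 fun i => eventually_pos_add_inv_mul _ _ _ (hrow i)
  obtain ⟨l, hl⟩ := Filter.eventually_atTop.1
    (hoffdiag.and (hrows.and (Filter.eventually_gt_atTop (g ⬝ᵥ h))))
  refine ⟨l, fun γ hγ => ?_⟩
  obtain ⟨ho, hr, hs⟩ := hl γ hγ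
  set t := (γ - g ⬝ᵥ h)⁻¹ with ht
  have htpos : 0 < t := inv_pos.2 (sub_pos.2 hs)
  have hmul : hatG G g γ * borderedInverse G⁻¹ h t = 1 :=
    hatG_mul_borderedInverse hGB hGh hgB (mul_inv_cancel₀ (sub_pos.2 hs).ne')
  rw [Matrix.inv_eq_right_inv hmul]
  refine ⟨Matrix.isUnit_det_of_right_inverse hmul, fun i j => ?_, fun i => ?_⟩
  · refine Fin.lastCases ?_ (fun i => ?_) i <;> refine Fin.lastCases ?_ (fun j => ?_) j
    · exact fun hne => (hne rfl).elim
    · intro _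
      simpa [borderedInverse] using mul_pos htpos (hpos j)
    · intro _
      simpa [borderedInverse] using mul_pos htpos (hpos i)
    · intro hne
      simp only [borderedInverse, Matrix.of_apply, Fin.lastCases_castSucc]
      linarith [ho i j fun hij => hne (congrArg _ hij)]
  · rw [Fin.sum_univ_castSucc]
    refine Fin.lastCases ?_ (fun i => ?_) i
    · simp only [borderedInverse, Matrix.of_apply, Fin.lastCases_castSucc, Fin.lastCases_last,
        Finset.sum_neg_distrib, ← Finset.mul_sum]
      linarith [mul_pos htpos (sub_pos.2 hsum)]
    · simp only [borderedInverse, Matrix.of_apply, Fin.lastCases_castSucc, Fin.lastCases_last,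
        Finset.sum_add_distrib, ← Finset.mul_sum]
      linarith [hr i]
end

section
/- Let P be a real n×k matrix with entries in {0,1} and linearly independent columns, and let v ∈ {0,1}ⁿ be a vector that is nonzero and distinct from every column of P. Suppose h = (PᵀP)^{-1}Pᵀv satisfies h_i > 0 for all i and ∑_i h_i < 1. Then vᵀv − vᵀPh > 0; equivalently, the columns of the matrix [P | v] are linearly independent. -/
open Matrix BigOperators

/-- The Gramian of a real matrix with linearly independent columns is invertible. -/
theorem isUnit_det_transpose_mul_self {m n : Type*} [Fintype m] [Fintype n] [DecidableEq n]
    {P : Matrix m n ℝ} (hli : LinearIndependent ℝ P.col) : IsUnit (Pᵀ * P).det := by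
  have hpd := Matrix.PosDef.conjTranspose_mul_self P (Matrix.mulVec_injective_iff.mpr hli)
  rw [Matrix.conjTranspose_eq_transpose_of_trivial] at hpd
  exact hpd.det_pos.ne'.isUnit

/-- A nonzero 0/1-vector is not a combination of the columns of a 0/1-matrix with nonnegative
coefficients summing to less than `1`. -/
theorem mulVec_ne_of_sum_lt_one {m n : Type*} [Fintype n] {P : Matrix m n ℝ}
    (h01 : ∀ i j, P i j = 0 ∨ P i j = 1) {v : m → ℝ} (hv01 : ∀ i, v i = 0 ∨ v i = 1)
    (hv0 : v ≠ 0) {h : n → ℝ} (hnonneg : ∀ j, 0 ≤ h j) (hsum : ∑ j, h j < 1) :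
    P *ᵥ h ≠ v := by
  rintro rfl
  refine hv0 (funext fun i => (hv01 i).resolve_right (ne_of_lt (lt_of_le_of_lt ?_ hsum)))
  refine Finset.sum_le_sum fun j _ => ?_
  rcases h01 i j with hij | hij <;> simp [hij, hnonneg j]

/-- If `h` solves the normal equations, then the residual of `v` is orthogonal to the column
span of `P`. -/
theorem dotProduct_self_sub_dotProduct_mulVec {m n : Type*} [Fintype m] [Fintype n]
    {P : Matrix m n ℝ} {v : m → ℝ} {h : n → ℝ} (hne : (Pᵀ * P) *ᵥ h = Pᵀ *ᵥ v) :
    v ⬝ᵥ v - v ⬝ᵥ (P *ᵥ h) = (v - P *ᵥ h) ⬝ᵥ (v - P *ᵥ h) := by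
  have horth : (v - P *ᵥ h) ⬝ᵥ (P *ᵥ h) = 0 := by
    rw [Matrix.dotProduct_mulVec, ← Matrix.mulVec_transpose, Matrix.mulVec_sub,
      Matrix.mulVec_mulVec, hne, sub_self, zero_dotProduct]
  rw [dotProduct_sub (v - P *ᵥ h), horth, sub_zero, sub_dotProduct, dotProduct_comm v (P *ᵥ h)]

/-- Let `P` be an `n × k` 0/1-matrix with linearly independent columns and let `v` be
a 0/1-vector, nonzero and distinct from every column of `P`. If `h = (PᵀP)⁻¹Pᵀv` has
positive entries summing to less than `1`, then the Schur complement
`vᵀv - vᵀPh` is positive; equivalently, the columns of `[P | v]` are linearly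
independent. -/
theorem schur_complement_pos (n k : ℕ) (P : Matrix (Fin n) (Fin k) ℝ)
    (h01 : ∀ i j, P i j = 0 ∨ P i j = 1)
    (hli : LinearIndependent ℝ fun j : Fin k => Pᵀ j)
    (v : Fin n → ℝ) (hv01 : ∀ i, v i = 0 ∨ v i = 1)
    (hv0 : v ≠ 0) (hvcol : ∀ j : Fin k, v ≠ Pᵀ j)
    (hpos : ∀ i, 0 < ((Pᵀ * P)⁻¹ *ᵥ (Pᵀ *ᵥ v)) i)
    (hsum : ∑ i, ((Pᵀ * P)⁻¹ *ᵥ (Pᵀ *ᵥ v)) i < 1) :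
    0 < v ⬝ᵥ v - v ⬝ᵥ (P *ᵥ ((Pᵀ * P)⁻¹ *ᵥ (Pᵀ *ᵥ v))) ∧
    LinearIndependent ℝ (Fin.snoc (fun j : Fin k => Pᵀ j) v : Fin (k + 1) → Fin n → ℝ) := by
  have hdet : IsUnit (Pᵀ * P).det := isUnit_det_transpose_mul_self hli
  have hne := mulVec_ne_of_sum_lt_one h01 hv01 hv0 (fun j => (hpos j).le) hsum
  constructor
  · rw [dotProduct_self_sub_dotProduct_mulVec
      (by rw [Matrix.mulVec_mulVec, Matrix.mul_nonsing_inv _ hdet, Matrix.one_mulVec])]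
    refine lt_of_le_of_ne (Finset.sum_nonneg fun i _ => mul_self_nonneg _) fun h0 => ?_
    exact hne (sub_eq_zero.mp (dotProduct_self_eq_zero.mp h0.symm)).symm
  · refine linearIndependent_finSnoc.mpr ⟨hli, fun hmem => hne ?_⟩
    obtain ⟨c, rfl⟩ : v ∈ LinearMap.range P.mulVecLin := by
      rw [Matrix.range_mulVecLin]
      exact hmem
    rw [Matrix.mulVecLin_apply, Matrix.mulVec_mulVec c, Matrix.mulVec_mulVec c,
      Matrix.nonsing_inv_mul _ hdet, Matrix.one_mulVec]
end

section
/- For n ≥ 3, let P_n be the n×n matrix with entries in {0,1} whose first row is (1,1,…,1,0) and whose remaining n−1 rows form the block [I_{n−1} | e], where I_{n−1} is the (n−1)×(n−1) identity matrix and e is the all-ones column vector. Then the Gramian satisfies P_nᵀP_n = I_n + eeᵀ + (n−3)·e_n e_nᵀ (where e_n is the n-th standard basis vector), this Gramian is invertible, and its inverse has all off-diagonal entries negative and all row sums positive; hence P_n represents an acute 0/1-simplex (the antipodal n-simplex). -/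
open Matrix BigOperators

/-- The matrix `P_n` of the antipodal `n`-simplex: its first row is `(1,1,…,1,0)` and
its remaining `n - 1` rows form the block `[I_{n-1} | e]`. -/
def Pmat (n : ℕ) : Matrix (Fin n) (Fin n) ℝ :=
  Matrix.of fun i j =>
    if (i : ℕ) = 0 then (if (j : ℕ) < n - 1 then 1 else 0)
    else if (j : ℕ) < n - 1 then (if (i : ℕ) = (j : ℕ) + 1 then 1 else 0) else 1

lemma diagonal_add_ones_mul {ι : Type*} [Fintype ι] [DecidableEq ι] (w : ι → ℝ)
    (hw : ∀ i, 0 < w i) :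
    (diagonal (fun i => (w i)⁻¹) + Matrix.of (fun _ _ : ι => (1 : ℝ))) *
      (diagonal w - (1 + ∑ k, w k)⁻¹ • vecMulVec w w) = 1 := by
  have hS : 0 < 1 + ∑ k, w k := by
    have := Finset.sum_nonneg fun k (_ : k ∈ Finset.univ) => (hw k).le
    linarith
  have hones : Matrix.of (fun _ _ : ι => (1 : ℝ)) * diagonal w = vecMulVec 1 w := by
    ext i j
    simp [mul_diagonal, vecMulVec_apply]
  have hdiag : diagonal (fun i => (w i)⁻¹) * vecMulVec w w = vecMulVec 1 w := by
    ext i j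
    simp [diagonal_mul, vecMulVec_apply, (hw i).ne']
  have hvec : Matrix.of (fun _ _ : ι => (1 : ℝ)) * vecMulVec w w =
      (∑ k, w k) • vecMulVec 1 w := by
    ext i j
    simp [Matrix.mul_apply, vecMulVec_apply, Finset.sum_mul]
  have hid : diagonal (fun i => (w i)⁻¹) * diagonal w = 1 := by
    simp [diagonal_mul_diagonal, (hw _).ne']
  rw [add_mul, mul_sub, mul_sub, mul_smul_comm, mul_smul_comm, hones, hdiag, hvec, hid]
  ext i j
  simp only [Matrix.add_apply, Matrix.sub_apply, Matrix.smul_apply, smul_eq_mul]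
  field_simp
  ring

/-- The inverse of a positive diagonal matrix plus the all-ones matrix (Sherman–Morrison)
has negative off-diagonal entries and positive row sums. -/
lemma diagonal_add_ones_acute {ι : Type*} [Fintype ι] [DecidableEq ι] (w : ι → ℝ)
    (hw : ∀ i, 0 < w i) {G : Matrix ι ι ℝ}
    (hG : G = diagonal (fun i => (w i)⁻¹) + Matrix.of (fun _ _ : ι => (1 : ℝ))) :
    IsUnit G.det ∧ (∀ i j, i ≠ j → G⁻¹ i j < 0) ∧ (∀ i, 0 < ∑ j, G⁻¹ i j) := by
  have hS : 0 < 1 + ∑ k, w k := by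
    have := Finset.sum_nonneg fun k (_ : k ∈ Finset.univ) => (hw k).le
    linarith
  have hmul := diagonal_add_ones_mul w hw
  rw [← hG] at hmul
  rw [inv_eq_right_inv hmul]
  refine ⟨isUnit_det_of_right_inverse hmul, fun i j hij => ?_, fun i => ?_⟩
  · have : 0 < (1 + ∑ k, w k)⁻¹ * (w i * w j) :=
      mul_pos (inv_pos.mpr hS) (mul_pos (hw i) (hw j))
    simpa [diagonal_apply_ne _ hij, vecMulVec_apply] using this
  · have hrow : ∑ j, (diagonal w - (1 + ∑ k, w k)⁻¹ • vecMulVec w w) i j =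
        w i / (1 + ∑ k, w k) := by
      simp only [Matrix.sub_apply, Matrix.smul_apply, vecMulVec_apply, smul_eq_mul, Finset.sum_sub_distrib,
        diagonal_apply, Finset.sum_ite_eq, Finset.mem_univ, if_true, ← Finset.mul_sum]
      field_simp
      ring
    rw [hrow]
    exact div_pos (hw i) hS

lemma Pmat_gram (n : ℕ) (hn : 1 ≤ n) :
    (Pmat n)ᵀ * Pmat n =
      1 + Matrix.of (fun _ _ : Fin n => (1 : ℝ)) +
        ((n : ℝ) - 3) •
          Matrix.of (fun i j : Fin n =>
            if (i : ℕ) = n - 1 ∧ (j : ℕ) = n - 1 then (1 : ℝ) else 0) := by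
  obtain ⟨m, rfl⟩ := Nat.exists_eq_add_of_le' hn
  ext i j
  rw [Matrix.mul_apply, Fin.sum_univ_succ]
  induction i using Fin.lastCases with
  | last =>
    induction j using Fin.lastCases with
    | last => simp [Pmat]; ring
    | cast j =>
      simp [Pmat, Fin.val_inj, j.isLt.ne, (Fin.castSucc_lt_last j).ne']
  | cast i =>
    induction j using Fin.lastCases with
    | last =>
      simp [Pmat, Fin.val_inj, i.isLt.ne, (Fin.castSucc_lt_last i).ne]
    | cast j =>
      simp [Pmat, Fin.val_inj, i.isLt.ne, Matrix.one_apply]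
      simp only [add_comm, eq_comm]

/-- For `n ≥ 3`, the Gramian of `P_n` equals `I_n + eeᵀ + (n-3) eₙeₙᵀ`, it is
invertible, and its inverse has negative off-diagonal entries and positive row sums;
hence `P_n` represents an acute 0/1-simplex (the antipodal `n`-simplex). -/
theorem antipodal_simplex_acute (n : ℕ) (hn : 3 ≤ n) :
    (Pmat n)ᵀ * Pmat n =
      1 + Matrix.of (fun _ _ : Fin n => (1 : ℝ)) +
        ((n : ℝ) - 3) •
          Matrix.of (fun i j : Fin n =>
            if (i : ℕ) = n - 1 ∧ (j : ℕ) = n - 1 then (1 : ℝ) else 0) ∧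
    IsUnit ((Pmat n)ᵀ * Pmat n).det ∧
    (∀ i j, i ≠ j → ((Pmat n)ᵀ * Pmat n)⁻¹ i j < 0) ∧
    (∀ i, 0 < ∑ j, ((Pmat n)ᵀ * Pmat n)⁻¹ i j) := by
  have hgram := Pmat_gram n (by omega)
  have hn' : (0 : ℝ) < (n : ℝ) - 2 := by
    have : (3 : ℝ) ≤ n := by exact_mod_cast hn
    linarith
  refine ⟨hgram, diagonal_add_ones_acute
    (fun i : Fin n => if (i : ℕ) = n - 1 then ((n : ℝ) - 2)⁻¹ else 1) (fun i => ?_) ?_⟩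
  · split_ifs
    · exact inv_pos.mpr hn'
    · exact one_pos
  · rw [hgram]
    ext i j
    by_cases hij : i = j
    · subst hij
      by_cases hi : (i : ℕ) = n - 1
      · simp [hi]
        ring
      · simp [hi]
    · have : ¬((i : ℕ) = n - 1 ∧ (j : ℕ) = n - 1) := fun h =>
        hij (Fin.ext (h.1.trans h.2.symm))
      simp [hij, this]
end

section
/- Let n, k ≥ 1 and let P₁, P₂ be n×k matrices with Boolean entries. The following are equivalent: (a) there exist a permutation σ of {1,…,n} and a vector ε ∈ Boolⁿ such that P₂(i,j) = ε_i XOR P₁(σ(i), j) for all i, j (i.e., P₂ results from P₁ by a row permutation followed by complementing a subset of the rows); (b) the multiset of 2n functions {1,…,k} → Bool consisting of the n rows of P₁ together with the n entrywise complements of the rows of P₁ is equal to the multiset consisting of the n rows of P₂ together with the n entrywise complements of the rows of P₂. -/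
/-- The representative, vanishing at `j₀`, of the complementation class of a Boolean function. -/
def complNormalForm {ι : Type*} (j₀ : ι) (f : ι → Bool) : ι → Bool :=
  fun j => xor (f j₀) (f j)

lemma complNormalForm_not {ι : Type*} (j₀ : ι) (f : ι → Bool) :
    complNormalForm j₀ (fun j => !(f j)) = complNormalForm j₀ f := by
  funext j
  simp [complNormalForm]

lemma eq_xor_of_complNormalForm_eq {ι : Type*} {j₀ : ι} {f g : ι → Bool}
    (h : complNormalForm j₀ f = complNormalForm j₀ g) (j : ι) :
    f j = xor (xor (f j₀) (g j₀)) (g j) := by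
  have hj := congrFun h j
  simp only [complNormalForm] at hj
  rw [Bool.xor_assoc, ← hj, ← Bool.xor_assoc, Bool.xor_self, Bool.false_xor]

lemma Multiset.map_add_map_eq_bind {α β : Type*} (s : Multiset α) (f g : α → β) :
    s.map f + s.map g = s.bind fun a => {f a, g a} := by
  simp only [Multiset.insert_eq_cons, Multiset.bind_cons, Multiset.bind_singleton]

lemma pair_xor_eq {ι : Type*} (e : Bool) (f : ι → Bool) :
    ({fun j => xor e (f j), fun j => !(xor e (f j))} : Multiset (ι → Bool)) =
      {f, fun j => !(f j)} := by
  cases e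
  · simp
  · simpa using Multiset.pair_comm (fun j => !(f j)) f

lemma exists_perm_of_map_univ_eq {α β : Type*} [Fintype α] {f g : α → β}
    (h : Finset.univ.val.map f = Finset.univ.val.map g) :
    ∃ σ : Equiv.Perm α, ∀ a, g (σ a) = f a := by
  classical
  have hcard : ∀ b, Fintype.card {a // f a = b} = Fintype.card {a // g a = b} := by
    intro b
    have hb := congrArg (Multiset.count b) h
    simp only [Multiset.count_map] at hb
    simpa only [Fintype.card_subtype, Finset.card_def, Finset.filter_val, eq_comm] using hb
  exact ⟨Equiv.ofFiberEquiv fun b => Fintype.equivOfCardEq (hcard b),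
    Equiv.ofFiberEquiv_map _⟩

/-- Two Boolean `n × k` matrices are related by a row permutation followed by
complementation of a subset of the rows if and only if the multiset consisting of the
rows of the first matrix together with their entrywise complements equals the
corresponding multiset for the second matrix. -/
theorem row_perm_compl_iff_multiset_eq (n k : ℕ) (hn : 1 ≤ n) (hk : 1 ≤ k)
    (P₁ P₂ : Matrix (Fin n) (Fin k) Bool) :
    (∃ (σ : Equiv.Perm (Fin n)) (ε : Fin n → Bool),
        ∀ i j, P₂ i j = xor (ε i) (P₁ (σ i) j)) ↔
      (Multiset.map (fun i => P₁ i) Finset.univ.val +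
          Multiset.map (fun i => fun j => !(P₁ i j)) Finset.univ.val =
        Multiset.map (fun i => P₂ i) Finset.univ.val +
          Multiset.map (fun i => fun j => !(P₂ i j)) Finset.univ.val) := by
  constructor
  · rintro ⟨σ, ε, h⟩
    have hrow : ∀ i, P₂ i = fun j => xor (ε i) (P₁ (σ i) j) := fun i => funext (h i)
    rw [Multiset.map_add_map_eq_bind, Multiset.map_add_map_eq_bind]
    simp only [hrow, pair_xor_eq]
    conv_lhs => rw [← Multiset.map_univ_val_equiv σ, Multiset.bind_map]
  · intro h
    let c := complNormalForm (⟨0, hk⟩ : Fin k)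
    have hc := congrArg (Multiset.map c) h
    simp only [Multiset.map_add, Multiset.map_map, Function.comp_def, c,
      complNormalForm_not, ← two_nsmul] at hc
    have hmap := nsmul_right_injective two_ne_zero hc
    obtain ⟨σ, hσ⟩ := exists_perm_of_map_univ_eq hmap.symm
    exact ⟨σ, fun i => xor (P₂ i ⟨0, hk⟩) (P₁ (σ i) ⟨0, hk⟩), fun i =>
      eq_xor_of_complNormalForm_eq (hσ i).symm⟩
end
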